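/- Let K be a field of characteristic different from 2 and φ a nondegenerate quadratic form over K of height at most 2 (i.e. the splitting pattern {i(φ_L) : L/K a field extension} has at most 3 elements). Then G(φ) = K×² · Hyp₂(φ) = H(φ), where Hyp₂(φ) is the subgroup of K× generated by norms from finite 2-extensions L/K with φ_L hyperbolic. -/

import Mathlib

open scoped TensorProduct

/-- A (finite-dimensional) quadratic form over the field `K`, bundled with its
underlying vector space. -/
structure QF (K : Type) [Field K] where
  V : Type
  [iAG : AddCommGroup V]
  [iM : Module K V]
  [iFD : FiniteDimensional K V]
  q : QuadraticForm K V

namespace QF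

variable {K : Type} [Field K]

instance (φ : QF K) : AddCommGroup φ.V := φ.iAG
instance (φ : QF K) : Module K φ.V := φ.iM
instance (φ : QF K) : FiniteDimensional K φ.V := φ.iFD

/-- dimension of a quadratic form -/
noncomputable def dim (φ : QF K) : ℕ := Module.finrank K φ.V

/-- isometry of quadratic forms -/
def Equiv (φ ψ : QF K) : Prop := QuadraticMap.Equivalent φ.q ψ.q

/-- nondegeneracy of a quadratic form (via its polar bilinear form) -/
def Nondeg (φ : QF K) : Prop := (QuadraticMap.polarBilin φ.q).Nondegenerate

/-- scaling a quadratic form by a scalar -/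
def smul (a : K) (φ : QF K) : QF K := { V := φ.V, q := a • φ.q }

/-- orthogonal sum of quadratic forms -/
def add (φ ψ : QF K) : QF K := { V := φ.V × ψ.V, q := φ.q.prod ψ.q }

/-- the zero-dimensional quadratic form -/
noncomputable def zero : QF K := { V := Fin 0 → K, q := QuadraticMap.weightedSumSquares K (fun i : Fin 0 => (1 : K)) }

/-- the form `⟨1⟩` -/
noncomputable def one : QF K := { V := Fin 1 → K, q := QuadraticMap.weightedSumSquares K (fun _ : Fin 1 => (1 : K)) }

/-- the binary form `⟨1, -a⟩ = ⟪a⟫` -/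
noncomputable def bin (a : K) : QF K :=
  { V := Fin 2 → K, q := QuadraticMap.weightedSumSquares K ![(1 : K), -a] }

/-- tensor product of quadratic forms -/
noncomputable def tmul [Invertible (2 : K)] (φ ψ : QF K) : QF K :=
  { V := φ.V ⊗[K] ψ.V, q := QuadraticForm.tmul φ.q ψ.q }

/-- `m` copies of the hyperbolic plane `⟨1, -1⟩` -/
noncomputable def hyperbolics : ℕ → QF K
  | 0 => zero
  | m + 1 => add (bin 1) (hyperbolics m)

/-- a form is hyperbolic if it is isometric to a sum of hyperbolic planes -/
def IsHyperbolic (φ : QF K) : Prop := ∃ m : ℕ, φ.Equiv (hyperbolics m)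

/-- anisotropy -/
def Anisotropic (φ : QF K) : Prop := φ.q.Anisotropic

/-- the Witt index -/
noncomputable def wittIndex (φ : QF K) : ℕ :=
  sSup {m : ℕ | ∃ ψ : QF K, φ.Equiv (add (hyperbolics m) ψ)}

/-- a form is split if its anisotropic part has dimension at most one -/
def IsSplit (φ : QF K) : Prop :=
  ∃ (m : ℕ) (ψ : QF K), ψ.Anisotropic ∧ ψ.dim ≤ 1 ∧ φ.Equiv (add (hyperbolics m) ψ)

/-- `n`-fold orthogonal sum of a fixed form -/
noncomputable def nsmul : ℕ → QF K → QF K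
  | 0, _ => zero
  | n + 1, φ => add φ (nsmul n φ)

/-- orthogonal sum of a list of forms -/
noncomputable def sumList : List (QF K) → QF K
  | [] => zero
  | φ :: l => add φ (sumList l)

/-- the Pfister form `⟨⟨a₁, …, aₙ⟩⟩` -/
noncomputable def pfister [Invertible (2 : K)] : List K → QF K
  | [] => one
  | a :: l => tmul (bin a) (pfister l)

/-- Witt equivalence of quadratic forms -/
def WittEquiv (φ ψ : QF K) : Prop := IsHyperbolic (add φ (smul (-1) ψ))

/-- membership in the `n`-th power of the fundamental ideal: Witt equivalence
to an orthogonal sum of scaled `n`-fold Pfister forms -/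
def InFundPow [Invertible (2 : K)] (n : ℕ) (φ : QF K) : Prop :=
  ∃ (r : ℕ) (c : Fin r → K) (l : Fin r → (Fin n → K)),
    (∀ i, c i ≠ 0) ∧
    WittEquiv φ (sumList ((List.finRange r).map fun i => smul (c i) (pfister (List.ofFn (l i)))))

/-- the group of similarity factors `G(φ) = {a ∈ K× : aφ ≅ φ}`, as a set -/
def G (φ : QF K) : Set K := {a | a ≠ 0 ∧ (smul a φ).Equiv φ}

/-- similarity factors of a family of forms -/
def GT {r : ℕ} (φ : Fin r → QF K) : Set K := ⋂ i, G (φ i)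

end QF

/-- a bundled field extension of `K` -/
structure FieldExt (K : Type) [Field K] where
  carrier : Type
  [iF : Field carrier]
  [iA : Algebra K carrier]

attribute [instance] FieldExt.iF FieldExt.iA

namespace QF

variable {K : Type} [Field K]

/-- base change of a quadratic form along a field extension -/
noncomputable def baseChange [Invertible (2 : K)] (L : Type) [Field L] [Algebra K L]
    (φ : QF K) : QF L :=
  { V := L ⊗[K] φ.V, q := QuadraticForm.baseChange L φ.q }

end QF

/-- the set of nonzero norms of a finite field extension -/
def normSet (K : Type) [Field K] (L : Type) [Field L] [Algebra K L] : Set K :=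
  {a | ∃ x : L, x ≠ 0 ∧ Algebra.norm K x = a}

/-- a finite `2`-extension: a tower of quadratic extensions -/
def IsTwoExtension (K : Type) [Field K] (L : Type) [Field L] [Algebra K L] : Prop :=
  FiniteDimensional K L ∧
    ∃ (n : ℕ) (F : Fin (n + 1) → IntermediateField K L),
      F 0 = ⊥ ∧ F (Fin.last n) = ⊤ ∧
        ∀ i : Fin n, F i.castSucc ≤ F i.succ ∧
          IntermediateField.relfinrank (F i.castSucc) (F i.succ) = 2

/-- a multiquadratic extension: Galois with elementary abelian 2-group -/
def IsMultiquadratic (K : Type) [Field K] (L : Type) [Field L] [Algebra K L] : Prop :=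
  FiniteDimensional K L ∧ IsGalois K L ∧ ∀ σ : L ≃ₐ[K] L, σ * σ = 1

namespace QF

variable {K : Type} [Field K] [Invertible (2 : K)]

/-- generating set for `Hyp(φ)`: norms from finite extensions splitting `φ` -/
def hypSet (φ : QF K) : Set K :=
  {a | ∃ L : FieldExt K, FiniteDimensional K L.carrier ∧
    IsHyperbolic (baseChange L.carrier φ) ∧ a ∈ normSet K L.carrier}

/-- the subgroup `Hyp(φ)` generated by norms of finite extensions splitting `φ` -/
def Hyp (φ : QF K) : Submonoid K := Submonoid.closure (hypSet φ)

/-- generating set for `Hyp₂(φ)`: norms from finite 2-extensions splitting `φ` -/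
def hypSet2 (φ : QF K) : Set K :=
  {a | ∃ L : FieldExt K, IsTwoExtension K L.carrier ∧
    IsHyperbolic (baseChange L.carrier φ) ∧ a ∈ normSet K L.carrier}

/-- the subgroup `Hyp₂(φ)` -/
def Hyp2 (φ : QF K) : Submonoid K := Submonoid.closure (hypSet2 φ)

/-- `H(φ) = K×² · Hyp(φ)` -/
def Hgrp (φ : QF K) : Set K :=
  {x | ∃ s : K, s ≠ 0 ∧ ∃ h ∈ Hyp φ, x = s ^ 2 * h}

/-- `K×² · Hyp₂(φ)` -/
def H2grp (φ : QF K) : Set K :=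
  {x | ∃ s : K, s ≠ 0 ∧ ∃ h ∈ Hyp2 φ, x = s ^ 2 * h}

/-- the splitting pattern: the set of Witt indices over all field extensions -/
def Sp (φ : QF K) : Set ℕ :=
  {m | ∃ L : FieldExt K, m = wittIndex (baseChange L.carrier φ)}

end QF

namespace QF

variable {K : Type} [Field K] [Invertible (2 : K)]

/-- norms from finite extensions splitting all forms in a family -/
def hypSetT {r : ℕ} (φ : Fin r → QF K) : Set K :=
  {a | ∃ L : FieldExt K, FiniteDimensional K L.carrier ∧
    (∀ i, IsHyperbolic (baseChange L.carrier (φ i))) ∧ a ∈ normSet K L.carrier}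

/-- the subgroup `Hyp` of a family of forms -/
def HypT {r : ℕ} (φ : Fin r → QF K) : Submonoid K := Submonoid.closure (hypSetT φ)

/-- norms from finite 2-extensions splitting all forms in a family -/
def hypSet2T {r : ℕ} (φ : Fin r → QF K) : Set K :=
  {a | ∃ L : FieldExt K, IsTwoExtension K L.carrier ∧
    (∀ i, IsHyperbolic (baseChange L.carrier (φ i))) ∧ a ∈ normSet K L.carrier}

/-- the subgroup `Hyp₂` of a family of forms -/
def Hyp2T {r : ℕ} (φ : Fin r → QF K) : Submonoid K := Submonoid.closure (hypSet2T φ)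

/-- `H` of a family of forms: `K×² · Hyp` -/
def HgrpT {r : ℕ} (φ : Fin r → QF K) : Set K :=
  {x | ∃ s : K, s ≠ 0 ∧ ∃ h ∈ HypT φ, x = s ^ 2 * h}

end QF

/-- the map `O → O'` between valuation rings induced by a compatible field embedding -/
def liftVSHom {K M : Type} [Field K] [Field M] [Algebra K M]
    (O : ValuationSubring K) (OM : ValuationSubring M)
    (hc : ∀ x : K, x ∈ O ↔ algebraMap K M x ∈ OM) : O →+* OM where
  toFun x := ⟨algebraMap K M x, (hc x).1 x.2⟩
  map_one' := by ext; simp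
  map_mul' x y := by ext; simp
  map_zero' := by ext; simp
  map_add' x y := by ext; simp

/-- `v` is unramified in the subextension `E` of `M/K`: the value group does not grow
and the residue field extension is separable (every residue is a simple root of a
separable polynomial over the residue field of `O`) -/
def UnramifiedIn {K M : Type} [Field K] [Field M] [Algebra K M]
    (O : ValuationSubring K) (OM : ValuationSubring M)
    (hc : ∀ x : K, x ∈ O ↔ algebraMap K M x ∈ OM) (E : IntermediateField K M) : Prop :=
  (∀ y : M, y ∈ E → y ≠ 0 →
      ∃ x : K, x ≠ 0 ∧ OM.valuation y = OM.valuation (algebraMap K M x)) ∧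
  (∀ y : M, y ∈ E → ∀ hy : y ∈ OM, ∃ p : Polynomial O, p.Monic ∧
      (p.map (IsLocalRing.residue O)).Separable ∧
      Polynomial.eval (⟨y, hy⟩ : OM) (p.map (liftVSHom O OM hc)) ∈ IsLocalRing.maximalIdeal OM)

/-- the value group of a valuation, as a subgroup of the units of the codomain -/
def unitsValueGroup {L Γ : Type} [Field L] [LinearOrderedCommGroupWithZero Γ]
    (w : Valuation L Γ) : Subgroup Γˣ :=
  (Units.map w.toMonoidWithZeroHom.toMonoidHom).range

/-- iterated Laurent series field, bundled with its field structure -/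
noncomputable def IterLaurentP (k : Type) [Field k] : ℕ → Σ' (T : Type), Field T :=
  fun n => Nat.rec ⟨k, ‹Field k›⟩
    (fun _ p => by letI := p.2; exact ⟨LaurentSeries p.1, inferInstance⟩) n

/-- iterated Laurent series field `k((t₁))…((tₙ))` -/
@[reducible] noncomputable def IterLaurent (k : Type) [Field k] (n : ℕ) : Type :=
  (IterLaurentP k n).1

noncomputable instance (k : Type) [Field k] (n : ℕ) : Field (IterLaurent k n) :=
  (IterLaurentP k n).2

/-- the embedding of the coefficient field in the iterated Laurent series field -/
noncomputable def iterC (k : Type) [Field k] : ∀ n, k →+* IterLaurent k n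
  | 0 => RingHom.id k
  | n + 1 => (HahnSeries.C : IterLaurent k n →+* LaurentSeries (IterLaurent k n)).comp (iterC k n)

/-- the variables `t₁, …, tₙ` of the iterated Laurent series field -/
noncomputable def tvar (k : Type) [Field k] : ∀ n, Fin n → IterLaurent k n
  | 0 => fun i => i.elim0
  | n + 1 => fun i =>
      (Fin.lastCases (motive := fun _ => LaurentSeries (IterLaurent k n))
        (HahnSeries.single 1 1) (fun j => HahnSeries.C (tvar k n j)) i : IterLaurent k (n + 1))

open scoped TensorProduct
namespace QFH
open QuadraticMap

variable {F : Type} [Field F]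

/-- totally isotropic subspace -/
def TI (φ : QF F) (I : Submodule F φ.V) : Prop := ∀ v ∈ I, φ.q v = 0

/-- existence of a totally isotropic subspace of given dimension -/
def HasTI (φ : QF F) (m : ℕ) : Prop := ∃ I : Submodule F φ.V, TI φ I ∧ Module.finrank F I = m

/-- nondegeneracy, elementary form -/
def ND (φ : QF F) : Prop := ∀ v, (∀ w, polar φ.q v w = 0) → v = 0

lemma nd_of_nondeg {φ : QF F} (h : φ.Nondeg) : ND φ := fun v hv => h.1 v hv

lemma polar_eq_of_ti {φ : QF F} {I : Submodule F φ.V} (h : TI φ I) {u v : φ.V} (hu : u ∈ I)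
    (hv : v ∈ I) : polar φ.q u v = 0 := by
  simp [polar, h _ hu, h _ hv, h _ (I.add_mem hu hv)]

lemma nd_equiv {φ ψ : QF F} (e : φ.Equiv ψ) (h : ND φ) : ND ψ := by
  obtain ⟨e⟩ := e
  intro v hv
  have : e.symm v = 0 := by
    apply h
    intro w
    have := hv (e w)
    rw [polar, ← e.apply_symm_apply v, ← map_add, e.map_app, e.map_app, e.map_app] at this
    exact this
  simpa using congrArg e this

lemma finrank_equiv {φ ψ : QF F} (e : φ.Equiv ψ) :
    Module.finrank F φ.V = Module.finrank F ψ.V := by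
  obtain ⟨e⟩ := e
  exact e.toLinearEquiv.finrank_eq

lemma hasTI_equiv {φ ψ : QF F} (e : φ.Equiv ψ) {m : ℕ} (h : HasTI φ m) : HasTI ψ m := by
  obtain ⟨e⟩ := e
  obtain ⟨I, hI, hm⟩ := h
  refine ⟨I.map (e.toLinearEquiv : φ.V →ₗ[F] ψ.V), ?_, ?_⟩
  · rintro _ ⟨v, hv, rfl⟩
    exact (e.map_app v).trans (hI v hv)
  · rw [← hm]
    exact LinearEquiv.finrank_map_eq e.toLinearEquiv I

lemma equiv_refl (φ : QF F) : φ.Equiv φ := QuadraticMap.Equivalent.refl _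
lemma equiv_symm {φ ψ : QF F} (e : φ.Equiv ψ) : ψ.Equiv φ := QuadraticMap.Equivalent.symm e
lemma equiv_trans {φ ψ χ : QF F} (e : φ.Equiv ψ) (f : ψ.Equiv χ) : φ.Equiv χ :=
  QuadraticMap.Equivalent.trans e f

lemma add_congr {φ φ' ψ ψ' : QF F} (e : φ.Equiv φ') (f : ψ.Equiv ψ') :
    (φ.add ψ).Equiv (φ'.add ψ') := by
  obtain ⟨e⟩ := e
  obtain ⟨f⟩ := f
  exact ⟨e.prod f⟩

lemma add_assoc' (φ ψ χ : QF F) : ((φ.add ψ).add χ).Equiv (φ.add (ψ.add χ)) := by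
  refine ⟨{ LinearEquiv.prodAssoc F φ.V ψ.V χ.V with map_app' := ?_ }⟩
  rintro ⟨⟨a, b⟩, c⟩
  exact (add_assoc (φ.q a) (ψ.q b) (χ.q c)).symm

lemma zero_q (x : Fin 0 → F) : weightedSumSquares F (fun _ : Fin 0 => (1 : F)) x = 0 := by
  simp [weightedSumSquares_apply]

lemma bin_q (x : Fin 2 → F) :
    weightedSumSquares F ![(1 : F), -1] x = x 0 * x 0 - x 1 * x 1 := by
  simp [weightedSumSquares_apply]; ring

lemma add_zero_left (φ : QF F) : (QF.zero.add φ).Equiv φ := by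
  refine ⟨{ LinearEquiv.uniqueProd (R := F) (M := φ.V) (M₂ := Fin 0 → F) with map_app' := ?_ }⟩
  rintro ⟨a, v⟩
  have : (QF.zero (K := F)).q a = 0 := zero_q (F := F) a
  change φ.q v = (QF.zero (K := F)).q a + φ.q v
  rw [this, zero_add]

lemma add_zero_right (φ ψ : QF F) (h : Module.finrank F ψ.V = 0) : (φ.add ψ).Equiv φ := by
  have : Subsingleton ψ.V := Module.finrank_zero_iff.mp h
  have : Unique ψ.V := uniqueOfSubsingleton 0
  refine ⟨{ LinearEquiv.prodUnique (R := F) (M := φ.V) (M₂ := ψ.V) with map_app' := ?_ }⟩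
  rintro ⟨a, v⟩
  have : v = 0 := Subsingleton.elim _ _
  subst this
  change φ.q a = φ.q a + ψ.q 0
  rw [map_zero, add_zero]

lemma finrank_add (φ ψ : QF F) : Module.finrank F (φ.add ψ).V =
    Module.finrank F φ.V + Module.finrank F ψ.V := Module.finrank_prod

lemma finrank_hyp (m : ℕ) : Module.finrank F (QF.hyperbolics (K := F) m).V = 2 * m := by
  induction m with
  | zero => exact Module.finrank_fin_fun F
  | succ m ih =>
    have : Module.finrank F (QF.bin (1 : F)).V = 2 := Module.finrank_fin_fun F
    rw [QF.hyperbolics, finrank_add, ih, this]; ring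

lemma polar_add (φ ψ : QF F) (a c : φ.V) (b d : ψ.V) :
    polar (φ.add ψ).q ((a, b) : φ.V × ψ.V) ((c, d) : φ.V × ψ.V)
      = polar φ.q a c + polar ψ.q b d := by
  change (φ.q (a + c) + ψ.q (b + d)) - (φ.q a + ψ.q b) - (φ.q c + ψ.q d) = _
  simp only [polar]; ring

lemma nd_right {φ ψ : QF F} (h : ND (φ.add ψ)) : ND ψ := by
  intro v hv
  have := h ((0, v) : φ.V × ψ.V) (by
    rintro ⟨a, b⟩
    refine (polar_add φ ψ 0 a v b).trans ?_
    simp [hv])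
  exact congrArg Prod.snd this

lemma finrank_subprod {V W : Type} [AddCommGroup V] [Module F V] [AddCommGroup W] [Module F W]
    [FiniteDimensional F V] [FiniteDimensional F W] (I : Submodule F V) (J : Submodule F W) :
    Module.finrank F (I.prod J) = Module.finrank F I + Module.finrank F J := by
  rw [← Module.finrank_prod]
  have h : LinearMap.range (I.subtype.prodMap J.subtype) = I.prod J := by
    rw [LinearMap.range_prodMap]; simp
  rw [← h, LinearMap.finrank_range_of_inj]
  exact Prod.map_injective.mpr ⟨I.injective_subtype, J.injective_subtype⟩

lemma hasTI_add {φ ψ : QF F} {m n : ℕ} (h : HasTI φ m) (h' : HasTI ψ n) :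
    HasTI (φ.add ψ) (m + n) := by
  obtain ⟨I, hI, hm⟩ := h
  obtain ⟨J, hJ, hn⟩ := h'
  refine ⟨(I.prod J : Submodule F (φ.V × ψ.V)), ?_, ?_⟩
  · rintro ⟨a, b⟩ ⟨ha, hb⟩
    change φ.q a + ψ.q b = 0
    rw [hI a ha, hJ b hb, add_zero]
  · rw [← hm, ← hn]
    exact finrank_subprod I J

lemma hasTI_zero (φ : QF F) : HasTI φ 0 :=
  ⟨⊥, by rintro v hv; rw [(Submodule.mem_bot F).mp hv, map_zero], finrank_bot F _⟩

lemma hasTI_bin : HasTI (QF.bin (1 : F)) 1 := by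
  refine ⟨(Submodule.span F {(fun _ => 1 : Fin 2 → F)} : Submodule F (Fin 2 → F)), ?_, ?_⟩
  · intro v hv
    obtain ⟨c, rfl⟩ := (Submodule.mem_span_singleton (R := F) (M := Fin 2 → F)).mp hv
    refine (bin_q (c • (fun _ => 1 : Fin 2 → F))).trans ?_
    simp
  · refine finrank_span_singleton (K := F) (V := Fin 2 → F) ?_
    intro h
    exact one_ne_zero (congrFun h 0)

lemma hasTI_hyp (m : ℕ) : HasTI (QF.hyperbolics (K := F) m) m := by
  induction m with
  | zero => exact hasTI_zero _
  | succ m ih =>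
    rw [QF.hyperbolics, add_comm]
    exact hasTI_add hasTI_bin ih

lemma hasTI_of_hyp_add {φ ψ : QF F} {m : ℕ} (e : φ.Equiv ((QF.hyperbolics m).add ψ)) :
    HasTI φ m := by
  have := hasTI_add (hasTI_hyp (F := F) m) (hasTI_zero ψ)
  exact hasTI_equiv (equiv_symm e) this

/-- restriction of a form to a subspace -/
def restr (φ : QF F) (P : Submodule F φ.V) : QF F := { V := P, q := φ.q.comp P.subtype }

/-- splitting off a hyperbolic plane -/
lemma split_plane (h2 : (2 : F) ≠ 0) {φ : QF F} {e g : φ.V} (he : φ.q e = 0) (hg : φ.q g = 0)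
    (heg : polar φ.q e g = 1) :
    φ.Equiv ((QF.bin 1).add (restr φ
      (LinearMap.ker (polarBilin φ.q e) ⊓ LinearMap.ker (polarBilin φ.q g)))) := by
  set Q := LinearMap.ker (polarBilin φ.q e) ⊓ LinearMap.ker (polarBilin φ.q g) with hQ
  have hee : polar φ.q e e = 0 := by simp [he]
  have hgg : polar φ.q g g = 0 := by simp [hg]
  have hge : polar φ.q g e = 1 := by rw [polar_comm, heg]
  let f : ((Fin 2 → F) × Q) →ₗ[F] φ.V :=
    { toFun := fun x => (x.1 0 + x.1 1) • e + (x.1 0 - x.1 1) • g + (x.2 : φ.V)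
      map_add' := by intro x y; simp; module
      map_smul' := by intro c x; simp; module }
  have hf1 : ∀ x, polar φ.q e (f x) = x.1 0 - x.1 1 := by
    rintro ⟨x, v, hv⟩
    have h1 : polar φ.q e v = 0 := hv.1
    simp [f, polar_add_right, polar_smul_right, hee, heg, h1]
  have hf2 : ∀ x, polar φ.q g (f x) = x.1 0 + x.1 1 := by
    rintro ⟨x, v, hv⟩
    have h1 : polar φ.q g v = 0 := hv.2
    simp [f, polar_add_right, polar_smul_right, hgg, hge, h1]
  have hinj : Function.Injective f := by
    rw [← LinearMap.ker_eq_bot, LinearMap.ker_eq_bot']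
    intro x hx
    have h1 := hf1 x
    have h2' := hf2 x
    rw [hx, polar_zero_right] at h1 h2'
    have h0 : x.1 0 = 0 := by
      have : 2 * x.1 0 = 0 := by linear_combination -h1 - h2'
      simpa [h2] using this
    have h10 : x.1 1 = 0 := by linear_combination -h2' - h0
    have : (x.2 : φ.V) = 0 := by simpa [f, h0, h10] using hx
    ext i
    · fin_cases i <;> simp [h0, h10]
    · simpa using this
  have hsurj : Function.Surjective f := by
    intro v
    refine ⟨(![(polar φ.q g v + polar φ.q e v) / 2, (polar φ.q g v - polar φ.q e v) / 2],
      ⟨v - polar φ.q g v • e - polar φ.q e v • g, ?_, ?_⟩), ?_⟩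
    · change polar φ.q e _ = 0
      simp [polar_sub_right, polar_smul_right, hee, heg]
    · change polar φ.q g _ = 0
      simp [polar_sub_right, polar_smul_right, hgg, hge]
    · have a1 : (polar φ.q g v + polar φ.q e v) / 2 + (polar φ.q g v - polar φ.q e v) / 2
        = polar φ.q g v := by field_simp; ring
      have a2 : (polar φ.q g v + polar φ.q e v) / 2 - (polar φ.q g v - polar φ.q e v) / 2
        = polar φ.q e v := by field_simp; ring
      simp [f, a1, a2]
  refine equiv_symm ⟨{ LinearEquiv.ofBijective f ⟨hinj, hsurj⟩ with map_app' := ?_ }⟩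
  rintro ⟨x, v, hv⟩
  have h1 : polar φ.q e v = 0 := hv.1
  have h1' : polar φ.q g v = 0 := hv.2
  have key : ∀ x : Fin 2 → F, φ.q ((x 0 + x 1) • e + (x 0 - x 1) • g + v) =
      weightedSumSquares F ![(1 : F), -1] x + φ.q v := by
    intro x
    rw [QuadraticMap.map_add (⇑φ.q), QuadraticMap.map_add (⇑φ.q), polar_add_left,
      polar_smul_left, polar_smul_left,
      polar_smul_left, h1, h1', polar_smul_right, heg, QuadraticMap.map_smul,
      QuadraticMap.map_smul, he, hg, bin_q]
    simp
    ring
  exact key x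

lemma exists_hyp_pair {φ : QF F} (hnd : ND φ) {e : φ.V} (he0 : e ≠ 0) (he : φ.q e = 0) :
    ∃ g, φ.q g = 0 ∧ polar φ.q e g = 1 := by
  have : ∃ g, polar φ.q e g ≠ 0 := by
    by_contra! h
    exact he0 (hnd e h)
  obtain ⟨g, hg⟩ := this
  set c := polar φ.q e g with hc
  refine ⟨c⁻¹ • g - (φ.q (c⁻¹ • g)) • e, ?_, ?_⟩
  · rw [sub_eq_add_neg, ← neg_smul, QuadraticMap.map_add (⇑φ.q), QuadraticMap.map_smul _ (-_) e, he,
      polar_smul_right, polar_smul_left, polar_comm, ← hc]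
    simp [hg]
  · rw [polar_sub_right, polar_smul_right, polar_smul_right, ← hc, polar_self, he]
    simp [hg]

lemma exists_hyp (h2 : (2 : F) ≠ 0) (m : ℕ) : ∀ φ : QF F, ND φ → HasTI φ m →
    ∃ ψ : QF F, ND ψ ∧ φ.Equiv ((QF.hyperbolics m).add ψ) := by
  induction m with
  | zero => exact fun φ h _ => ⟨φ, h, equiv_symm (add_zero_left φ)⟩
  | succ m ih =>
    rintro φ hnd ⟨I, hI, hm⟩
    have : I ≠ ⊥ := by rintro rfl; simp at hm
    obtain ⟨e, heI, he0⟩ := Submodule.exists_mem_ne_zero_of_ne_bot this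
    obtain ⟨g, hg, heg⟩ := exists_hyp_pair hnd he0 (hI e heI)
    have hs := split_plane h2 (hI e heI) hg heg
    set Q := LinearMap.ker (polarBilin φ.q e) ⊓ LinearMap.ker (polarBilin φ.q g) with hQ
    have hTI : HasTI (restr φ Q) m := by
      let l : I →ₗ[F] F := (polarBilin φ.q g).comp I.subtype
      have hl : l ≠ 0 := by
        intro h0
        have : polar φ.q g e = 0 := LinearMap.congr_fun h0 ⟨e, heI⟩
        rw [polar_comm, heg] at this
        exact one_ne_zero this
      have hk : Module.finrank F (LinearMap.ker l) = m := by
        have h3 := LinearMap.finrank_range_add_finrank_ker l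
        have h4 : Module.finrank F (LinearMap.range l) = 1 := by
          rw [LinearMap.range_eq_top.mpr (LinearMap.surjective hl)]; simp
        omega
      let j : LinearMap.ker l →ₗ[F] Q :=
        { toFun := fun v => ⟨(v : I), polar_eq_of_ti hI heI v.1.2, v.2⟩
          map_add' := fun _ _ => rfl
          map_smul' := fun _ _ => rfl }
      refine ⟨(LinearMap.range j : Submodule F Q), ?_, ?_⟩
      · rintro _ ⟨v, rfl⟩
        exact hI _ v.1.2
      · rw [← hk]
        refine LinearMap.finrank_range_of_inj (f := j) ?_
        intro a b hab
        have := congrArg Subtype.val hab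
        exact Subtype.ext (Subtype.ext this)
    obtain ⟨ψ, hψ, e'⟩ := ih _ (nd_right (nd_equiv hs hnd)) hTI
    refine ⟨ψ, hψ, ?_⟩
    exact equiv_trans hs (equiv_trans (add_congr (equiv_refl _) e')
      (equiv_symm (add_assoc' _ _ _)))

lemma two_mul_le (h2 : (2 : F) ≠ 0) {m : ℕ} {φ : QF F} (hnd : ND φ) (h : HasTI φ m) :
    2 * m ≤ Module.finrank F φ.V := by
  obtain ⟨ψ, -, e⟩ := exists_hyp h2 m φ hnd h
  rw [finrank_equiv e, finrank_add, finrank_hyp]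
  omega

lemma equiv_hyp (h2 : (2 : F) ≠ 0) {m : ℕ} {φ : QF F} (hnd : ND φ) (h : HasTI φ m)
    (hm : Module.finrank F φ.V = 2 * m) : φ.Equiv (QF.hyperbolics m) := by
  obtain ⟨ψ, -, e⟩ := exists_hyp h2 m φ hnd h
  have := finrank_equiv e
  rw [finrank_add, finrank_hyp] at this
  exact equiv_trans e (add_zero_right _ _ (by omega))

lemma isHyperbolic_iff (h2 : (2 : F) ≠ 0) {φ : QF F} (hnd : ND φ) :
    φ.IsHyperbolic ↔ ∃ m, Module.finrank F φ.V = 2 * m ∧ HasTI φ m := by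
  constructor
  · rintro ⟨m, e⟩
    exact ⟨m, by rw [finrank_equiv e, finrank_hyp], hasTI_equiv (equiv_symm e) (hasTI_hyp m)⟩
  · rintro ⟨m, hm, h⟩
    exact ⟨m, equiv_hyp h2 hnd h hm⟩

lemma wittIndex_spec (h2 : (2 : F) ≠ 0) {φ : QF F} (hnd : ND φ) :
    HasTI φ φ.wittIndex ∧ ∀ m, HasTI φ m → m ≤ φ.wittIndex := by
  have hb : BddAbove {m : ℕ | ∃ ψ : QF F, φ.Equiv ((QF.hyperbolics m).add ψ)} := by
    refine ⟨Module.finrank F φ.V, ?_⟩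
    rintro m ⟨ψ, e⟩
    have := two_mul_le h2 hnd (hasTI_of_hyp_add e)
    omega
  constructor
  · have : φ.wittIndex ∈ {m : ℕ | ∃ ψ : QF F, φ.Equiv ((QF.hyperbolics m).add ψ)} :=
      Nat.sSup_mem ⟨0, φ, equiv_symm (add_zero_left φ)⟩ hb
    obtain ⟨ψ, e⟩ := this
    exact hasTI_of_hyp_add e
  · intro m hm
    obtain ⟨ψ, -, e⟩ := exists_hyp h2 m φ hnd hm
    exact le_csSup hb ⟨ψ, e⟩

end QFH

open scoped TensorProduct
namespace QFH
open QuadraticMap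

variable {F : Type} [Field F]

lemma one_q (c : F) (x : Fin 1 → F) :
    (c • weightedSumSquares F (fun _ : Fin 1 => (1 : F))) x = c * (x 0 * x 0) := by
  simp [weightedSumSquares_apply]

/-- splitting off an anisotropic vector -/
lemma split_vec (h2 : (2 : F) ≠ 0) {φ : QF F} {v : φ.V} {c : F} (hv : φ.q v = c) (hc : c ≠ 0) :
    φ.Equiv ((QF.one.smul c).add (restr φ (LinearMap.ker (polarBilin φ.q v)))) := by
  set Q := LinearMap.ker (polarBilin φ.q v) with hQ
  have hvv : polar φ.q v v = 2 * c := by simp [hv]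
  have hvv0 : polar φ.q v v ≠ 0 := by rw [hvv]; exact mul_ne_zero h2 hc
  let f : ((Fin 1 → F) × Q) →ₗ[F] φ.V :=
    { toFun := fun x => (x.1 0) • v + (x.2 : φ.V)
      map_add' := by intro x y; simp; module
      map_smul' := by intro c x; simp; module }
  have hf1 : ∀ x, polar φ.q v (f x) = x.1 0 * polar φ.q v v := by
    rintro ⟨x, u, hu⟩
    have h1 : polar φ.q v u = 0 := hu
    change polar φ.q v (x 0 • v + u) = _
    rw [polar_add_right, polar_smul_right, h1]
    simp only [smul_eq_mul, add_zero]
  have hinj : Function.Injective f := by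
    rw [← LinearMap.ker_eq_bot, LinearMap.ker_eq_bot']
    intro x hx
    have h1 := hf1 x
    rw [hx, polar_zero_right] at h1
    have h0 : x.1 0 = 0 := by
      rcases mul_eq_zero.mp h1.symm with h | h
      · exact h
      · exact absurd h hvv0
    have : (x.2 : φ.V) = 0 := by simpa [f, h0] using hx
    ext i
    · fin_cases i; simp [h0]
    · simpa using this
  have hsurj : Function.Surjective f := by
    intro u
    refine ⟨(fun _ => polar φ.q v u / polar φ.q v v,
      ⟨u - (polar φ.q v u / polar φ.q v v) • v, ?_⟩), ?_⟩
    · change polar φ.q v _ = 0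
      rw [polar_sub_right, polar_smul_right, smul_eq_mul, div_mul_cancel₀ _ hvv0, sub_self]
    · simp [f]
  refine equiv_symm ⟨{ LinearEquiv.ofBijective f ⟨hinj, hsurj⟩ with map_app' := ?_ }⟩
  rintro ⟨x, u, hu⟩
  have h1 : polar φ.q v u = 0 := hu
  have key : ∀ x : Fin 1 → F, φ.q (x 0 • v + u) =
      (c • weightedSumSquares F (fun _ : Fin 1 => (1 : F))) x + φ.q u := by
    intro x
    rw [QuadraticMap.map_add (⇑φ.q), polar_smul_left, h1, QuadraticMap.map_smul, hv, one_q]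
    simp
    ring
  exact key x

lemma finrank_one (c : F) : Module.finrank F (QF.one.smul c).V = 1 := Module.finrank_fin_fun F

/-- Witt cancellation, in Lagrangian form -/
lemma lag_equiv (h2 : (2 : F) ≠ 0) (n : ℕ) : ∀ φ ψ : QF F, ND φ → ND ψ →
    Module.finrank F φ.V = n → Module.finrank F ψ.V = n → ∀ T : Submodule F (φ.V × ψ.V),
    (∀ t ∈ T, φ.q t.1 = ψ.q t.2) → n ≤ Module.finrank F T → φ.Equiv ψ := by
  induction n with
  | zero =>
    intro φ ψ hφ hψ h1 h2' T hT hn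
    exact equiv_trans (equiv_hyp (m := 0) h2 hφ (hasTI_zero φ) h1)
      (equiv_symm (equiv_hyp (m := 0) h2 hψ (hasTI_zero ψ) h2'))
  | succ n ih =>
    intro φ ψ hφ hψ h1 h2' T hT hn
    by_cases hex : ∃ t ∈ T, φ.q t.1 ≠ 0
    · obtain ⟨⟨v, w⟩, ht, hv0⟩ := hex
      have hvw := hT _ ht
      simp only at hvw hv0
      have e1 := split_vec (φ := φ) h2 rfl hv0
      have e2 := split_vec (φ := ψ) (v := w) h2 hvw.symm hv0
      refine equiv_trans e1 (equiv_trans (add_congr (equiv_refl _) ?_) (equiv_symm e2))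
      have f1 := finrank_equiv e1
      have f2 := finrank_equiv e2
      rw [finrank_add, finrank_one] at f1 f2
      have hpol : ∀ t ∈ T, polar φ.q v t.1 = polar ψ.q w t.2 := by
        intro t htT
        have h3 := hT _ htT
        have h4 := hT _ (T.add_mem ht htT)
        simp only [Prod.fst_add, Prod.snd_add] at h4
        simp only [polar, h3, h4, hvw]
      let l : T →ₗ[F] F := (polarBilin φ.q v).comp ((LinearMap.fst F φ.V ψ.V).comp T.subtype)
      let j : LinearMap.ker l →ₗ[F] ((LinearMap.ker (polarBilin φ.q v)) × (LinearMap.ker (polarBilin ψ.q w))) :=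
        { toFun := fun t => (⟨(t : T).1.1, t.2⟩, ⟨(t : T).1.2, by
            have : polar φ.q v (t : T).1.1 = 0 := t.2
            rw [hpol _ t.1.2] at this
            exact this⟩)
          map_add' := fun _ _ => rfl
          map_smul' := fun _ _ => rfl }
      refine ih (restr φ _) (restr ψ _) (nd_right (nd_equiv e1 hφ)) (nd_right (nd_equiv e2 hψ))
        (by omega) (by omega) (LinearMap.range j) ?_ ?_
      · rintro _ ⟨t, rfl⟩
        exact hT _ t.1.2
      · have h3 := LinearMap.finrank_range_add_finrank_ker l
        have h4 : Module.finrank F (LinearMap.range l) ≤ 1 := by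
          simpa using Submodule.finrank_le (LinearMap.range l)
        have h5 : Module.finrank F (LinearMap.range j) = Module.finrank F (LinearMap.ker l) := by
          refine LinearMap.finrank_range_of_inj ?_
          intro a b hab
          have q1 := congrArg (fun z => ((z.1 : φ.V), (z.2 : ψ.V))) hab
          exact Subtype.ext (Subtype.ext q1)
        have h6 : n ≤ Module.finrank F (LinearMap.range j) := by omega
        exact h6
    · push Not at hex
      let p : T →ₗ[F] φ.V := (LinearMap.fst F φ.V ψ.V).comp T.subtype
      let r : LinearMap.ker p →ₗ[F] ψ.V :=
        (LinearMap.snd F φ.V ψ.V).comp (T.subtype.comp (LinearMap.ker p).subtype)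
      have hr : Function.Injective r := by
        intro a b hab
        have ha : (a : T).1.1 = 0 := a.2
        have hb : (b : T).1.1 = 0 := b.2
        exact Subtype.ext (Subtype.ext (Prod.ext (ha.trans hb.symm) hab))
      have t1 : HasTI φ (Module.finrank F (LinearMap.range p)) := by
        refine ⟨LinearMap.range p, ?_, rfl⟩
        rintro _ ⟨t, rfl⟩
        exact hex _ t.2
      have t2 : HasTI ψ (Module.finrank F (LinearMap.range r)) := by
        refine ⟨LinearMap.range r, ?_, rfl⟩
        rintro _ ⟨t, rfl⟩
        have := hT _ t.1.2
        rw [hex _ t.1.2] at this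
        exact this.symm
      have h3 := LinearMap.finrank_range_add_finrank_ker p
      have h4 := LinearMap.finrank_range_of_inj hr
      have h5 := two_mul_le h2 hφ t1
      have h6 := two_mul_le h2 hψ t2
      set a := Module.finrank F (LinearMap.range p)
      have hab : Module.finrank F (LinearMap.range r) = a := by omega
      rw [hab] at t2
      exact equiv_trans (equiv_hyp h2 hφ t1 (by omega))
        (equiv_symm (equiv_hyp h2 hψ t2 (by omega)))

/-- orthogonal of a subspace -/
def perp {V : Type} [AddCommGroup V] [Module F V] (C : V →ₗ[F] V →ₗ[F] F) (J : Submodule F V) :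
    Submodule F V where
  carrier := {v | ∀ j ∈ J, C v j = 0}
  add_mem' := by
    intro a b ha hb j hj
    simp [ha j hj, hb j hj]
  zero_mem' := by intro j _; simp
  smul_mem' := by
    intro c a ha j hj
    simp [ha j hj]

lemma count {V : Type} [AddCommGroup V] [Module F V] [FiniteDimensional F V]
    (C : V →ₗ[F] V →ₗ[F] F) (T J : Submodule F V) (hT : ∀ t ∈ T, ∀ t' ∈ T, C t t' = 0) :
    Module.finrank F T + Module.finrank F (T ⊓ J : Submodule F V) ≤
      Module.finrank F J + Module.finrank F (T ⊓ perp C J : Submodule F V) := by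
  let g : T →ₗ[F] Module.Dual F J :=
    (LinearMap.lcomp F F J.subtype).comp (C.comp T.subtype)
  have hg : ∀ t j, g t j = C t j := fun _ _ => rfl
  have h1 := LinearMap.finrank_range_add_finrank_ker g
  let W : Submodule F J := (T ⊓ J).comap J.subtype
  have h2 : LinearMap.range g ≤ W.dualAnnihilator := by
    rintro _ ⟨t, rfl⟩
    rw [Submodule.mem_dualAnnihilator]
    intro w hw
    rw [hg]
    exact hT _ t.2 _ hw.1
  have h3 := Submodule.finrank_mono h2
  have h4 := Subspace.finrank_add_finrank_dualAnnihilator_eq W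
  have h5 : Module.finrank F W = Module.finrank F (T ⊓ J : Submodule F V) :=
    (Submodule.comapSubtypeEquivOfLe inf_le_right).finrank_eq
  have h6 : Module.finrank F (LinearMap.ker g) ≤ Module.finrank F (T ⊓ perp C J : Submodule F V) := by
    let k : LinearMap.ker g →ₗ[F] (T ⊓ perp C J : Submodule F V) :=
      { toFun := fun t => ⟨(t : T), t.1.2, fun j hj => LinearMap.congr_fun t.2 ⟨j, hj⟩⟩
        map_add' := fun _ _ => rfl
        map_smul' := fun _ _ => rfl }
    refine LinearMap.finrank_le_finrank_of_injective (f := k) ?_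
    intro a b hab
    have q1 := congrArg Subtype.val hab
    exact Subtype.ext (Subtype.ext q1)
  omega

lemma count' {V : Type} [AddCommGroup V] [Module F V] [FiniteDimensional F V]
    (C : V →ₗ[F] V →ₗ[F] F) (T J : Submodule F V) (hT : ∀ t ∈ T, ∀ t' ∈ T, C t t' = 0)
    (hJ : Module.finrank F J < Module.finrank F T) :
    ∃ t ∈ T, (∀ j ∈ J, C t j = 0) ∧ t ∉ J := by
  by_contra! h
  have h1 := count C T J hT
  have h2 : T ⊓ perp C J ≤ T ⊓ J := fun t ht => ⟨ht.1, h t ht.1 ht.2⟩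
  have h3 := Submodule.finrank_mono h2
  omega

end QFH

open scoped TensorProduct
namespace QFH
open QuadraticMap

variable {F : Type} [Field F] {ι : Type} [Fintype ι]

/-- diagonal form -/
noncomputable def wq (w : ι → F) : QF F := { V := ι → F, q := weightedSumSquares F w }

/-- its bilinear form -/
noncomputable def B (w : ι → F) : (ι → F) →ₗ[F] (ι → F) →ₗ[F] F :=
  LinearMap.mk₂ F (fun u v => ∑ i, w i * (u i * v i))
    (by intro a b c; simp [← Finset.sum_add_distrib, add_mul, mul_add])
    (by intro c a b; simp [Finset.mul_sum]; refine Finset.sum_congr rfl fun i _ => by ring)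
    (by intro a b c; simp [← Finset.sum_add_distrib, mul_add])
    (by intro c a b; simp [Finset.mul_sum]; refine Finset.sum_congr rfl fun i _ => by ring)

lemma B_apply (w : ι → F) (u v : ι → F) : B w u v = ∑ i, w i * (u i * v i) := rfl

lemma B_comm (w : ι → F) (u v : ι → F) : B w u v = B w v u := by
  simp [B_apply, mul_comm]

lemma wq_q (w : ι → F) (v : ι → F) : (wq w).q v = B w v v := by
  change weightedSumSquares F w v = _
  simp [weightedSumSquares_apply, B_apply]

lemma wq_polar (w : ι → F) (u v : ι → F) : polar (wq w).q u v = 2 * B w u v := by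
  have h : polar (wq w).q u v = B w (u + v) (u + v) - B w u u - B w v v :=
    congrArg₂ (· - ·) (congrArg₂ (· - ·) (wq_q w (u + v)) (wq_q w u)) (wq_q w v)
  rw [h]
  simp only [map_add, LinearMap.add_apply, B_comm w v u]
  ring

lemma wq_nd (h2 : (2 : F) ≠ 0) {w : ι → F} (hw : ∀ i, w i ≠ 0) : ND (wq w) := by
  classical
  have : ∀ v : ι → F, (∀ u : ι → F, polar (wq w).q v u = 0) → v = 0 := by
    intro v hv
    ext i
    have := hv (Pi.single i 1)
    rw [wq_polar, B_apply] at this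
    simpa [h2, Pi.single_apply, hw i] using this
  exact this

lemma wq_finrank (w : ι → F) : Module.finrank F (wq w).V = Fintype.card ι :=
  Module.finrank_fintype_fun_eq_card F

lemma ti_B (h2 : (2 : F) ≠ 0) {w : ι → F} {I : Submodule F (ι → F)}
    (hI : ∀ v ∈ I, B w v v = 0) {u v : ι → F} (hu : u ∈ I) (hv : v ∈ I) : B w u v = 0 := by
  have := hI _ (I.add_mem hu hv)
  simp only [map_add, LinearMap.add_apply, hI u hu, hI v hv, B_comm w v u] at this
  have h3 : 2 * B w u v = 0 := by linear_combination this
  simpa [h2] using h3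

/-- concrete version of HasTI -/
lemma hasTI_wq {w : ι → F} {m : ℕ} : HasTI (wq w) m ↔
    ∃ I : Submodule F (ι → F), (∀ v ∈ I, B w v v = 0) ∧ Module.finrank F I = m := by
  constructor
  · rintro ⟨I, hI, hm⟩
    exact ⟨I, fun v hv => (wq_q w v).symm.trans (hI v hv), hm⟩
  · rintro ⟨I, hI, hm⟩
    exact ⟨I, fun v hv => (wq_q w v).trans (hI v hv), hm⟩

lemma extend {w : ι → F} {I : Submodule F (ι → F)}
    (hI : ∀ v ∈ I, B w v v = 0) {z : ι → F} (hz : ∀ i ∈ I, B w z i = 0) (hzz : B w z z = 0)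
    (hzI : z ∉ I) : HasTI (wq w) (Module.finrank F I + 1) := by
  rw [hasTI_wq]
  refine ⟨I ⊔ Submodule.span F {z}, ?_, ?_⟩
  · intro v hv
    obtain ⟨y, hy, z', hz', rfl⟩ := Submodule.mem_sup.mp hv
    obtain ⟨c, rfl⟩ := Submodule.mem_span_singleton.mp hz'
    simp [hI y hy, hz y hy, B_comm w y z, hzz]
  · have hz0 : z ≠ 0 := by rintro rfl; exact hzI I.zero_mem
    have h1 := Submodule.finrank_sup_add_finrank_inf_eq I (Submodule.span F {z})
    have h2 : I ⊓ Submodule.span F {z} = ⊥ := by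
      rw [← disjoint_iff]
      exact (Submodule.disjoint_span_singleton' hz0).mpr hzI
    rw [h2, finrank_bot, finrank_span_singleton hz0] at h1
    omega

/-- extension of a subspace to a quadratic extension -/
def extSub (b : F) [Fact (∀ r : F, r ^ 2 ≠ b + 0 * r)] (I : Submodule F (ι → F)) :
    Submodule (QuadraticAlgebra F b 0) (ι → QuadraticAlgebra F b 0) where
  carrier := {v | (fun i => (v i).re) ∈ I ∧ (fun i => (v i).im) ∈ I}
  add_mem' := by
    rintro u v ⟨h1, h2⟩ ⟨h3, h4⟩
    exact ⟨I.add_mem h1 h3, I.add_mem h2 h4⟩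
  zero_mem' := ⟨I.zero_mem, I.zero_mem⟩
  smul_mem' := by
    rintro c v ⟨h1, h2⟩
    constructor
    · have := I.add_mem (I.smul_mem c.re h1) (I.smul_mem (b * c.im) h2)
      convert this using 1
      ext i
      simp
    · have := I.add_mem (I.smul_mem c.re h2) (I.smul_mem c.im h1)
      convert this using 1
      ext i
      simp

lemma finrank_extSub (b : F) [Fact (∀ r : F, r ^ 2 ≠ b + 0 * r)] (I : Submodule F (ι → F)) :
    Module.finrank (QuadraticAlgebra F b 0) (extSub b I) = Module.finrank F I := by
  have h1 := Module.finrank_mul_finrank F (QuadraticAlgebra F b 0) (extSub b I)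
  rw [QuadraticAlgebra.finrank_eq_two] at h1
  let e : (extSub b I) ≃ₗ[F] (I × I) :=
    { toFun := fun v => (⟨fun i => (v.1 i).re, v.2.1⟩, ⟨fun i => (v.1 i).im, v.2.2⟩)
      map_add' := fun _ _ => rfl
      map_smul' := fun _ _ => rfl
      invFun := fun p => ⟨fun i => ⟨p.1.1 i, p.2.1 i⟩, p.1.2, p.2.2⟩
      left_inv := fun _ => rfl
      right_inv := fun _ => rfl }
  have h3 := e.finrank_eq
  rw [Module.finrank_prod] at h3
  omega

/-- extended weights -/
abbrev ext (L : Type) [Field L] [Algebra F L] (w : ι → F) : ι → L := fun i => algebraMap F L (w i)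

lemma B_re (b : F) [Fact (∀ r : F, r ^ 2 ≠ b + 0 * r)] (w : ι → F)
    (u v : ι → QuadraticAlgebra F b 0) :
    (B (ext _ w) u v).re = B w (fun i => (u i).re) (fun i => (v i).re) +
      b * B w (fun i => (u i).im) (fun i => (v i).im) := by
  have : ∀ f : ι → QuadraticAlgebra F b 0, (∑ i, f i).re = ∑ i, (f i).re := fun f =>
    map_sum (QuadraticAlgebra.reₗ b 0) f _
  simp only [B_apply, this, Finset.mul_sum, ← Finset.sum_add_distrib]
  refine Finset.sum_congr rfl fun i _ => ?_
  simp [QuadraticAlgebra.algebraMap_eq]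
  ring

lemma B_im (b : F) [Fact (∀ r : F, r ^ 2 ≠ b + 0 * r)] (w : ι → F)
    (u v : ι → QuadraticAlgebra F b 0) :
    (B (ext _ w) u v).im = B w (fun i => (u i).re) (fun i => (v i).im) +
      B w (fun i => (u i).im) (fun i => (v i).re) := by
  have : ∀ f : ι → QuadraticAlgebra F b 0, (∑ i, f i).im = ∑ i, (f i).im := fun f =>
    map_sum (QuadraticAlgebra.imₗ b 0) f _
  simp only [B_apply, this, ← Finset.sum_add_distrib]
  refine Finset.sum_congr rfl fun i _ => ?_
  simp [QuadraticAlgebra.algebraMap_eq]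
  ring

lemma mem_of_max {w : ι → F} {I : Submodule F (ι → F)} (hI : ∀ v ∈ I, B w v v = 0)
    (hmax : ¬ HasTI (wq w) (Module.finrank F I + 1)) {z : ι → F} (hz : ∀ i ∈ I, B w z i = 0)
    (hzz : B w z z = 0) : z ∈ I := by
  by_contra h
  exact hmax (extend hI hz hzz h)

/-- the key step: two anisotropic core vectors -/
lemma jump (h2 : (2 : F) ≠ 0) {w : ι → F} {I : Submodule F (ι → F)} (hI : ∀ v ∈ I, B w v v = 0)
    (hmax : ¬ HasTI (wq w) (Module.finrank F I + 1)) {e v : ι → F}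
    (he : ∀ i ∈ I, B w e i = 0) (hv : ∀ i ∈ I, B w v i = 0) (hee : B w e e ≠ 0) :
    (∃ g, B w e e * B w v v = g ^ 2) ∨ ∃ (b β : F) (_ : Fact (∀ r : F, r ^ 2 ≠ b + 0 * r)),
      B w e e * B w v v = β ^ 2 - b ∧
      HasTI (wq (ext (QuadraticAlgebra F b 0) w)) (Module.finrank F I + 1) := by
  set c := B w e e with hc
  set c' := B w v v with hc'
  set β := B w e v with hβ
  by_cases hsq : ∃ g, g ^ 2 = β ^ 2 - c * c'
  · left
    obtain ⟨g, hg⟩ := hsq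
    have key : ∀ s : F, s ^ 2 = β ^ 2 - c * c' → (β + s) • e - c • v ∈ I := by
      intro s hs
      apply mem_of_max hI hmax
      · intro i hi
        simp [he i hi, hv i hi]
      · simp only [map_sub, map_smul, LinearMap.sub_apply, LinearMap.smul_apply, ← hc, ← hc',
          ← hβ, B_comm w v e, smul_eq_mul]
        linear_combination c * hs
    have h1 := key g hg
    have h3 := key (-g) (by rw [neg_sq, hg])
    have h4 := I.sub_mem h1 h3
    have h5 : (2 * g) • e ∈ I := by
      convert h4 using 1
      module
    have hg0 : g = 0 := by
      by_contra hg0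
      have : e ∈ I := (I.smul_mem_iff (mul_ne_zero h2 hg0)).mp h5
      exact hee (hI e this)
    exact ⟨β, by rw [hg0] at hg; linear_combination hg⟩
  · right
    push Not at hsq
    have hF : Fact (∀ r : F, r ^ 2 ≠ (β ^ 2 - c * c') + 0 * r) := ⟨fun r => by
      rw [zero_mul, add_zero]; exact hsq r⟩
    refine ⟨β ^ 2 - c * c', β, hF, by ring, ?_⟩
    rw [← finrank_extSub (β ^ 2 - c * c') I]
    refine extend (z := fun i => ⟨β * e i - c * v i, e i⟩) ?_ ?_ ?_ ?_
    · rintro u ⟨hu1, hu2⟩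
      ext
      · rw [B_re, hI _ hu1, hI _ hu2]; simp
      · rw [B_im, ti_B h2 hI hu1 hu2, ti_B h2 hI hu2 hu1]; simp
    · rintro u ⟨hu1, hu2⟩
      have e1 : (fun i => β * e i - c * v i) = β • e - c • v := rfl
      ext
      · rw [B_re]
        simp only [e1]
        simp [he _ hu1, he _ hu2, hv _ hu1]
      · rw [B_im]
        simp only [e1]
        simp [he _ hu1, he _ hu2, hv _ hu2]
    · have e1 : (fun i => β * e i - c * v i) = β • e - c • v := rfl
      have e2 : (fun i => e i) = e := rfl
      ext
      · rw [B_re]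
        simp only [e1, map_sub, map_smul, LinearMap.sub_apply, LinearMap.smul_apply, ← hc, ← hc',
          ← hβ, B_comm w v e, smul_eq_mul, QuadraticAlgebra.re_zero]
        ring
      · rw [B_im]
        simp only [e1, map_sub, map_smul, LinearMap.sub_apply, LinearMap.smul_apply, ← hc, ← hc',
          ← hβ, B_comm w v e, smul_eq_mul, QuadraticAlgebra.im_zero]
        ring
    · rintro ⟨-, hz⟩
      exact hee (hI e hz)

end QFH

open scoped TensorProduct
namespace QFH
open QuadraticMap

variable {F : Type} [Field F] {ι : Type} [Fintype ι]

lemma step1 (h2 : (2 : F) ≠ 0) {w : ι → F} {I : Submodule F (ι → F)} (hI : ∀ v ∈ I, B w v v = 0)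
    (hmax : ¬ HasTI (wq w) (Module.finrank F I + 1)) (hlt : 2 * Module.finrank F I < Fintype.card ι)
    {x : F} (hx : x ≠ 0) (f : (ι → F) →ₗ[F] (ι → F)) (hf : ∀ u v, B w (f u) (f v) = x * B w u v) :
    (∃ g, x = g ^ 2) ∨ ∃ (b β c : F) (_ : Fact (∀ r : F, r ^ 2 ≠ b + 0 * r)), c ≠ 0 ∧
      c ^ 2 * x = β ^ 2 - b ∧
      HasTI (wq (ext (QuadraticAlgebra F b 0) w)) (Module.finrank F I + 1) := by
  let C : ((ι → F) × (ι → F)) →ₗ[F] ((ι → F) × (ι → F)) →ₗ[F] F :=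
    ((B w).compl₁₂ (LinearMap.fst F _ _) (LinearMap.fst F _ _)) -
      x • ((B w).compl₁₂ (LinearMap.snd F _ _) (LinearMap.snd F _ _))
  have hC : ∀ a c, C a c = B w a.1 c.1 - x * B w a.2 c.2 := fun _ _ => rfl
  let gf : (ι → F) →ₗ[F] ((ι → F) × (ι → F)) := f.prod LinearMap.id
  have hg : ∀ v, gf v = (f v, v) := fun _ => rfl
  have hinj : Function.Injective gf := fun a b h => congrArg Prod.snd h
  obtain ⟨t, ⟨v, rfl⟩, ht, htJ⟩ := count' C (LinearMap.range gf) (I.prod I)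
    (by
      rintro _ ⟨a, rfl⟩ _ ⟨b, rfl⟩
      simp [hC, hg, hf])
    (by
      rw [LinearMap.finrank_range_of_inj hinj, finrank_subprod, Module.finrank_fintype_fun_eq_card]
      omega)
  have h1 : ∀ i ∈ I, B w (f v) i = 0 := fun i hi => by
    simpa [hC, hg] using ht (i, 0) ⟨hi, I.zero_mem⟩
  have h3 : ∀ i ∈ I, B w v i = 0 := fun i hi => by
    simpa [hC, hg, hx] using ht (0, i) ⟨I.zero_mem, hi⟩
  have hc : B w v v ≠ 0 := by
    intro hc
    exact htJ ⟨mem_of_max hI hmax h1 ((hf v v).trans (by rw [hc, mul_zero])), mem_of_max hI hmax h3 hc⟩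
  rcases jump h2 hI hmax h3 h1 hc with ⟨g, hg⟩ | ⟨b, β, hF, h4, h5⟩
  · left
    refine ⟨g / B w v v, ?_⟩
    rw [hf] at hg
    field_simp
    linear_combination hg
  · right
    refine ⟨b, β, B w v v, hF, hc, ?_, h5⟩
    rw [hf] at h4
    linear_combination h4

lemma find (b : F) [Fact (∀ r : F, r ^ 2 ≠ b + 0 * r)] {w : ι → QuadraticAlgebra F b 0}
    {I : Submodule (QuadraticAlgebra F b 0) (ι → QuadraticAlgebra F b 0)}
    (hI : ∀ v ∈ I, B w v v = 0)
    (hmax : ¬ HasTI (wq w) (Module.finrank (QuadraticAlgebra F b 0) I + 1))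
    (hlt : 2 * Module.finrank (QuadraticAlgebra F b 0) I < Fintype.card ι)
    {y : QuadraticAlgebra F b 0} (hy : y ≠ 0)
    (g : (ι → F) →ₗ[F] (ι → QuadraticAlgebra F b 0)) (hg : Function.Injective g)
    (hB : ∀ u v, (y * B w (g u) (g v)).im = 0) :
    ∃ t, (∀ i ∈ I, B w t i = 0) ∧ B w t t ≠ 0 ∧ (y * B w t t).im = 0 := by
  let C : (ι → QuadraticAlgebra F b 0) →ₗ[F] (ι → QuadraticAlgebra F b 0) →ₗ[F] F :=
    LinearMap.mk₂ F (fun u v => (y * B w u v).im)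
      (by intro a b c; simp [mul_add])
      (by
        intro c u v
        have : B w (c • u) v = c • B w u v := by
          have := LinearMap.map_smul_of_tower (B w) c u
          rw [this]; rfl
        rw [this, mul_smul_comm, QuadraticAlgebra.im_smul])
      (by intro a b c; simp [mul_add])
      (by
        intro c u v
        have : B w u (c • v) = c • B w u v := LinearMap.map_smul_of_tower (B w u) c v
        rw [this, mul_smul_comm, QuadraticAlgebra.im_smul])
  have hC : ∀ a c, C a c = (y * B w a c).im := fun _ _ => rfl
  obtain ⟨t, ⟨v, rfl⟩, ht, htJ⟩ := count' C (LinearMap.range g) (I.restrictScalars F)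
    (by
      rintro _ ⟨a, rfl⟩ _ ⟨b, rfl⟩
      exact hB a b)
    (by
      rw [LinearMap.finrank_range_of_inj hg, Module.finrank_fintype_fun_eq_card]
      have h1 := Module.finrank_mul_finrank F (QuadraticAlgebra F b 0) I
      rw [QuadraticAlgebra.finrank_eq_two] at h1
      have h3 : Module.finrank F (I.restrictScalars F) = Module.finrank F I := rfl
      omega)
  have h1 : ∀ i ∈ I, B w (g v) i = 0 := fun i hi => by
    have h3 : ∀ l : QuadraticAlgebra F b 0, (l * (y * B w (g v) i)).im = 0 := by
      intro l
      have := ht (l • i) (I.smul_mem l hi)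
      rw [hC, map_smul, smul_eq_mul] at this
      rw [mul_left_comm]; exact this
    have h4 : y * B w (g v) i = 0 := by
      ext
      · simpa using h3 ⟨0, 1⟩
      · simpa using h3 1
    simpa [hy] using h4
  exact ⟨g v, h1, fun h => htJ (mem_of_max hI hmax h1 h), hB v v⟩

lemma norm_quad (b : F) [Fact (∀ r : F, r ^ 2 ≠ b + 0 * r)] (z : QuadraticAlgebra F b 0) :
    Algebra.norm F z = z.re ^ 2 - b * z.im ^ 2 := by
  rw [Algebra.norm_apply]
  have := QuadraticAlgebra.det_toLinearMap_eq_norm z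
  rw [QuadraticAlgebra.norm_def] at this
  refine Eq.trans ?_ (this.trans ?_)
  · rfl
  · ring

lemma step2 (b : F) [Fact (∀ r : F, r ^ 2 ≠ b + 0 * r)] (h2 : (2 : F) ≠ 0) {w : ι → F}
    {I : Submodule (QuadraticAlgebra F b 0) (ι → QuadraticAlgebra F b 0)}
    (hI : ∀ v ∈ I, B (ext _ w) v v = 0)
    (hmax : ¬ HasTI (wq (ext (QuadraticAlgebra F b 0) w)) (Module.finrank (QuadraticAlgebra F b 0) I + 1))
    (hlt : 2 * Module.finrank (QuadraticAlgebra F b 0) I < Fintype.card ι)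
    {β : F} (f : (ι → F) →ₗ[F] (ι → F)) (hf : ∀ u v, B w (f u) (f v) = (β ^ 2 - b) * B w u v) :
    ∃ (h : QuadraticAlgebra F b 0) (s : F), h ≠ 0 ∧ s ≠ 0 ∧
      Algebra.norm F h * (β ^ 2 - b) = s ^ 2 ∧
      ((∃ g, h = g ^ 2) ∨ ∃ (b' β' : QuadraticAlgebra F b 0)
        (_ : Fact (∀ r : QuadraticAlgebra F b 0, r ^ 2 ≠ b' + 0 * r)),
      h = β' ^ 2 - b' ∧
      HasTI (wq (ext (QuadraticAlgebra (QuadraticAlgebra F b 0) b' 0) (ext (QuadraticAlgebra F b 0) w)))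
        (Module.finrank (QuadraticAlgebra F b 0) I + 1)) := by
  have h2' : (2 : QuadraticAlgebra F b 0) ≠ 0 := by
    have := (map_ne_zero (algebraMap F (QuadraticAlgebra F b 0))).mpr h2
    rwa [map_ofNat] at this
  have hy : (⟨β, 1⟩ : QuadraticAlgebra F b 0) ≠ 0 := by
    intro h
    have := congrArg QuadraticAlgebra.im h
    simp at this
  let g1 : (ι → F) →ₗ[F] (ι → QuadraticAlgebra F b 0) :=
    { toFun := fun v i => ⟨v i, 0⟩
      map_add' := by intro u v; ext i <;> simp
      map_smul' := by intro u v; ext i <;> simp }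
  let g2 : (ι → F) →ₗ[F] (ι → QuadraticAlgebra F b 0) :=
    { toFun := fun v i => ⟨(f v - β • v) i, v i⟩
      map_add' := by intro u v; ext i <;> simp; ring
      map_smul' := by intro u v; ext i <;> simp; ring }
  obtain ⟨e, he, hee, hec⟩ := find b hI hmax hlt one_ne_zero g1
    (by
      intro u v h
      ext i
      exact congrArg QuadraticAlgebra.re (congrFun h i))
    (by
      intro u v
      rw [one_mul, B_im]
      have : (fun i => (g1 u i).im) = 0 := rfl
      have h' : (fun i => (g1 v i).im) = 0 := rfl
      rw [this, h']
      simp)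
  obtain ⟨t, ht, htt, htc⟩ := find b hI hmax hlt hy g2
    (by
      intro u v h
      ext i
      exact congrArg QuadraticAlgebra.im (congrFun h i))
    (by
      intro u v
      rw [QuadraticAlgebra.im_mul, B_im, B_re]
      have a1 : ∀ u, (fun i => (g2 u i).im) = u := fun _ => rfl
      have a2 : ∀ u, (fun i => (g2 u i).re) = f u - β • u := fun _ => rfl
      simp only [a1, a2, map_sub, map_smul, LinearMap.sub_apply, LinearMap.smul_apply, smul_eq_mul,
        hf]
      ring)
  set c := B (ext (QuadraticAlgebra F b 0) w) e e with hc
  set d := B (ext (QuadraticAlgebra F b 0) w) t t with hd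
  rw [one_mul] at hec
  set y : QuadraticAlgebra F b 0 := ⟨β, 1⟩ with hyd
  have hc' : c.re ≠ 0 := fun h => hee (by ext <;> simp [h, hec])
  have hz' : (y * d).re ≠ 0 := fun h => (mul_ne_zero hy htt) (by ext <;> simp only [h, htc] <;> rfl)
  have hNy : Algebra.norm F y = β ^ 2 - b := by rw [norm_quad]; simp [y]
  refine ⟨c * d, c.re * (y * d).re, mul_ne_zero hee htt, mul_ne_zero hc' hz', ?_, ?_⟩
  · rw [← hNy, map_mul, mul_assoc, ← map_mul, mul_comm d y, norm_quad b c, norm_quad b (y * d), hec,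
      htc]
    ring
  · exact jump h2' hI hmax he ht hee

end QFH

open scoped TensorProduct
namespace QFH
open QuadraticMap

variable {F : Type} [Field F] {ι : Type} [Fintype ι]

section pb
open Polynomial
variable {L : Type} [Field L] [Algebra F L]

/-- polynomial representative -/
noncomputable def rep (pb : PowerBasis F L) : L →ₗ[F] F[X] :=
  ∑ r : Fin pb.dim, (monomial (r : ℕ)).comp (pb.basis.coord r)

lemma rep_apply (pb : PowerBasis F L) (a : L) :
    rep pb a = ∑ r : Fin pb.dim, monomial (r : ℕ) (pb.basis.repr a r) := by
  simp [rep]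

lemma rep_aeval (pb : PowerBasis F L) (a : L) : aeval pb.gen (rep pb a) = a := by
  rw [rep_apply, map_sum]
  conv_rhs => rw [← pb.basis.sum_repr a]
  refine Finset.sum_congr rfl fun r _ => ?_
  rw [aeval_monomial, pb.basis_eq_pow, Algebra.smul_def]

lemma rep_degree (pb : PowerBasis F L) (a : L) : (rep pb a).degree < pb.dim := by
  rw [rep_apply]
  refine (degree_sum_le _ _).trans_lt ?_
  rw [Finset.sup_lt_iff (by exact WithBot.bot_lt_coe _)]
  intro r _
  refine (degree_monomial_le _ _).trans_lt ?_
  exact_mod_cast r.2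

lemma rep_eq (pb : PowerBasis F L) (a : L) (Q : F[X]) (hQ : Q.degree < pb.dim)
    (ha : aeval pb.gen Q = a) : rep pb a = Q := by
  by_contra h
  have h1 := minpoly.degree_le_of_ne_zero F pb.gen (sub_ne_zero.mpr h)
    (by rw [map_sub, rep_aeval, ha, sub_self])
  rw [pb.degree_minpoly] at h1
  exact absurd (h1.trans (degree_sub_le _ _)) (not_le.mpr (max_lt (rep_degree pb a) hQ))

lemma dim_pos' (pb : PowerBasis F L) : 0 < pb.dim := pb.dim_pos

lemma rep_coeff_zero (pb : PowerBasis F L) (Q : F[X]) (hQ : Q.natDegree ≤ pb.dim) :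
    (rep pb (aeval pb.gen Q)).coeff 0 = Q.coeff 0 - Q.coeff pb.dim * (minpoly F pb.gen).coeff 0 := by
  have hm : (minpoly F pb.gen).Monic := minpoly.monic pb.isIntegral_gen
  rw [rep_eq pb _ (Q - C (Q.coeff pb.dim) * minpoly F pb.gen)]
  · simp
  · rw [degree_lt_iff_coeff_zero]
    intro r hr
    rw [coeff_sub, coeff_C_mul]
    rcases hr.eq_or_lt with rfl | hr
    · have : (minpoly F pb.gen).coeff pb.dim = 1 := by
        rw [← pb.natDegree_minpoly]; exact hm
      rw [this]; ring
    · rw [coeff_eq_zero_of_natDegree_lt (hQ.trans_lt hr),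
        coeff_eq_zero_of_natDegree_lt (p := minpoly F pb.gen) (by rwa [pb.natDegree_minpoly])]
      ring
  · simp

lemma rep_vanish (pb : PowerBasis F L) (hx : pb.gen ≠ 0) (k : ℕ) (a : L)
    (h : ∀ j, 1 ≤ j → j ≤ k → (rep pb (a * pb.gen ^ j)).coeff 0 = 0) (r : ℕ)
    (hr : pb.dim ≤ r + k) : (rep pb a).coeff r = 0 := by
  by_contra hne
  set P := rep pb a with hP
  have h1 : r ≤ P.natDegree := le_natDegree_of_ne_zero hne
  have hP0 : P ≠ 0 := by rintro h; simp [h] at hne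
  have h2 : P.natDegree < pb.dim := by
    rw [natDegree_lt_iff_degree_lt hP0]; exact rep_degree pb a
  have h3 := h (pb.dim - P.natDegree) (by omega) (by omega)
  have h4 : a * pb.gen ^ (pb.dim - P.natDegree) =
      aeval pb.gen (P * X ^ (pb.dim - P.natDegree)) := by
    rw [map_mul, hP, rep_aeval, map_pow, aeval_X]
  rw [h4, rep_coeff_zero] at h3
  · rw [coeff_mul_X_pow', if_neg (by omega)] at h3
    have h5 : (P * X ^ (pb.dim - P.natDegree)).coeff pb.dim = P.leadingCoeff := by
      rw [coeff_mul_X_pow', if_pos (by omega)]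
      congr 1; omega
    rw [h5, zero_sub, neg_eq_zero, mul_eq_zero] at h3
    rcases h3 with h3 | h3
    · exact hP0 (leadingCoeff_eq_zero.mp h3)
    · exact minpoly.coeff_zero_ne_zero pb.isIntegral_gen hx h3
  · refine natDegree_mul_le.trans ?_
    rw [natDegree_X_pow]; omega

lemma rep_sq (pb : PowerBasis F L) (D : ℕ) (hD : 2 * D ≤ pb.dim) (a : L)
    (h : ∀ r, D < r → (rep pb a).coeff r = 0) :
    (rep pb (a * a)).coeff 0 = (rep pb a).coeff 0 * (rep pb a).coeff 0 -
      (if 2 * D = pb.dim then (rep pb a).coeff D * (rep pb a).coeff D else 0) *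
        (minpoly F pb.gen).coeff 0 := by
  set P := rep pb a with hP
  have h4 : a * a = aeval pb.gen (P * P) := by
    rw [map_mul, hP, rep_aeval]
  have h1 : P.natDegree ≤ D := natDegree_le_iff_coeff_eq_zero.mpr h
  rw [h4, rep_coeff_zero, mul_coeff_zero]
  · congr 2
    split_ifs with h5
    · rw [← h5, two_mul, coeff_mul_add_eq_of_natDegree_le h1 h1]
    · apply coeff_eq_zero_of_natDegree_lt
      refine natDegree_mul_le.trans_lt ?_
      omega
  · refine natDegree_mul_le.trans ?_
    omega

lemma count2 {V W : Type} [AddCommGroup V] [Module F V] [FiniteDimensional F V]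
    [AddCommGroup W] [Module F W]
    (C : V →ₗ[F] V →ₗ[F] F) (T J : Submodule F V) (hT : ∀ t ∈ T, ∀ t' ∈ T, C t t' = 0)
    (G : V →ₗ[F] W) (hG : ∀ t ∈ T, t ∈ perp C J → G t = 0 → t ∈ J) :
    Module.finrank F T ≤ Module.finrank F J +
      Module.finrank F ((T ⊓ perp C J : Submodule F V).map G) := by
  have h1 := count C T J hT
  set S := (T ⊓ perp C J : Submodule F V) with hS
  have h2 := (G.comp S.subtype).finrank_range_add_finrank_ker
  rw [LinearMap.range_comp, Submodule.range_subtype] at h2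
  have h3 : Module.finrank F (LinearMap.ker (G.comp S.subtype)) ≤
      Module.finrank F (T ⊓ J : Submodule F V) := by
    let g : LinearMap.ker (G.comp S.subtype) →ₗ[F] (T ⊓ J : Submodule F V) :=
      (S.subtype.comp (LinearMap.ker (G.comp S.subtype)).subtype).codRestrict _
        (fun t => ⟨t.1.2.1, hG _ t.1.2.1 t.1.2.2 t.2⟩)
    refine LinearMap.finrank_le_finrank_of_injective (f := g) ?_
    intro a b h
    have h' : ((a : S) : V) = ((b : S) : V) :=
      congrArg (fun t : (T ⊓ J : Submodule F V) => (t : V)) h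
    exact Subtype.ext (Subtype.ext h')
  omega

lemma transfer (pb : PowerBasis F L) (hx : pb.gen ≠ 0) (k D : ℕ) (hk : k + D + 1 = pb.dim)
    (hD : 2 * D ≤ pb.dim) {w : ι → F} (hw : ∀ i, w i ≠ 0)
    (h2 : (2 : L) ≠ 0) {m : ℕ} (h : HasTI (wq (ext L w)) m) :
    ∃ T : Submodule F ((ι → F) × (ι → F)), m * pb.dim ≤ Fintype.card ι * k + Module.finrank F T ∧
      ∀ t ∈ T, if 2 * D = pb.dim then B w t.1 t.1 = (minpoly F pb.gen).coeff 0 * B w t.2 t.2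
        else B w t.1 t.1 = 0 ∧ t.2 = 0 := by
  classical
  obtain ⟨I, hI, hm⟩ := hasTI_wq.mp h
  have hfd : FiniteDimensional F L := pb.finite
  have coeffL : ℕ → F[X] →ₗ[F] F := fun r => lcoeff F r
  let s : L →ₗ[F] F := (lcoeff F 0).comp (rep pb)
  have hs : ∀ a, s a = (rep pb a).coeff 0 := fun _ => rfl
  let Cf : (ι → L) →ₗ[F] (ι → L) →ₗ[F] F :=
    LinearMap.mk₂ F (fun u v => s (B (ext L w) u v))
      (by intro a b c; simp)
      (by
        intro c u v
        have : B (ext L w) (c • u) v = c • B (ext L w) u v := by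
          have := LinearMap.map_smul_of_tower (B (ext L w)) c u
          rw [this]; rfl
        rw [this, map_smul])
      (by intro a b c; simp)
      (by
        intro c u v
        have : B (ext L w) u (c • v) = c • B (ext L w) u v :=
          LinearMap.map_smul_of_tower (B (ext L w) u) c v
        rw [this, map_smul])
  have hC : ∀ u v, Cf u v = s (B (ext L w) u v) := fun _ _ => rfl
  let jm : (ι → Fin k → F) →ₗ[F] (ι → L) :=
    { toFun := fun c i => ∑ j : Fin k, c i j • pb.gen ^ ((j : ℕ) + 1)
      map_add' := by intro a b; ext i; simp [add_smul, Finset.sum_add_distrib]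
      map_smul' := by intro a b; ext i; simp [Finset.smul_sum, mul_smul] }
  have hjm : ∀ c i, jm c i = ∑ j : Fin k, c i j • pb.gen ^ ((j : ℕ) + 1) := fun _ _ => rfl
  let G : (ι → L) →ₗ[F] ((ι → F) × (ι → F)) :=
    { toFun := fun u => (fun i => (rep pb (u i)).coeff 0,
        fun i => if 2 * D = pb.dim then (rep pb (u i)).coeff D else 0)
      map_add' := by intro a b; ext i <;> simp; split_ifs <;> simp
      map_smul' := by intro a b; ext i <;> simp }
  have hperp : ∀ u, u ∈ perp Cf (LinearMap.range jm) → ∀ i r, D < r →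
      (rep pb (u i)).coeff r = 0 := by
    intro u hu i r hr
    refine rep_vanish pb hx k (u i) ?_ r (by omega)
    intro j hj1 hj2
    have := hu (jm (Pi.single i (Pi.single ⟨j - 1, by omega⟩ 1))) ⟨_, rfl⟩
    have e : jm (Pi.single i (Pi.single ⟨j - 1, by omega⟩ 1)) = Pi.single i (pb.gen ^ j) := by
      ext i'
      rw [hjm]
      by_cases hi : i' = i
      · subst hi
        simp only [Pi.single_eq_same]
        rw [Finset.sum_eq_single ⟨j - 1, by omega⟩]
        · simp [Nat.sub_add_cancel hj1]
        · intro b _ hb; simp [hb]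
        · simp
      · simp [hi]
    rw [e, hC, B_apply, Finset.sum_eq_single i] at this
    · rw [Pi.single_eq_same, ext, ← Algebra.smul_def, map_smul, smul_eq_mul, hs] at this
      simpa [hw i] using this
    · intro b _ hb; simp [hb]
    · simp
  refine ⟨(I.restrictScalars F ⊓ perp Cf (LinearMap.range jm)).map G, ?_, ?_⟩
  · have h1 := count2 Cf (I.restrictScalars F) (LinearMap.range jm)
      (by
        intro t ht t' ht'
        rw [hC, ti_B h2 hI ht ht', map_zero]) G
      (by
        intro u hu hup hGu
        have h0 : ∀ i, (rep pb (u i)).coeff 0 = 0 := fun i => congrFun (congrArg Prod.fst hGu) i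
        have hr : ∀ i r, k < r → (rep pb (u i)).coeff r = 0 := by
          intro i r hr
          by_cases hDr : D < r
          · exact hperp u hup i r hDr
          · have h3 : r = D := by omega
            have := congrFun (congrArg Prod.snd hGu) i
            change (if 2 * D = pb.dim then (rep pb (u i)).coeff D else 0) = 0 at this
            rw [if_pos (by omega)] at this
            rw [h3]; exact this
        refine ⟨fun i j => (rep pb (u i)).coeff (j + 1), ?_⟩
        ext i
        rw [hjm]
        conv_rhs => rw [← rep_aeval pb (u i)]
        rw [aeval_eq_sum_range' (n := k + 1) (Nat.lt_succ_of_le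
          (natDegree_le_iff_coeff_eq_zero.mpr (hr i))), Finset.sum_range_succ', h0, zero_smul,
          add_zero, Finset.sum_range])
    have h3 : Module.finrank F (I.restrictScalars F) = m * pb.dim := by
      have h1 := Module.finrank_mul_finrank F L I
      rw [pb.finrank, hm, mul_comm] at h1
      exact h1.symm
    have h4 : Module.finrank F (LinearMap.range jm) ≤ Fintype.card ι * k := by
      refine (LinearMap.finrank_range_le jm).trans ?_
      rw [Module.finrank_pi_fintype]
      simp
    rw [h3] at h1
    omega
  · rintro _ ⟨u, ⟨huI, hup⟩, rfl⟩
    have h1 : ∀ i, (rep pb (u i * u i)).coeff 0 = _ := fun i =>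
      rep_sq pb D hD (u i) (hperp u hup i)
    have h3 : s (B (ext L w) u u) = 0 := by rw [hI u huI, map_zero]
    have h5 : s (B (ext L w) u u) = ∑ i, w i * (rep pb (u i * u i)).coeff 0 := by
      rw [B_apply, map_sum]
      refine Finset.sum_congr rfl fun i _ => ?_
      rw [ext, ← Algebra.smul_def, map_smul, smul_eq_mul, hs]
    rw [h3] at h5
    simp only [h1] at h5
    split_ifs with hd
    · simp only [if_pos hd] at h5
      rw [B_apply, B_apply, Finset.mul_sum, ← sub_eq_zero, ← Finset.sum_sub_distrib, h5]
      refine Finset.sum_congr rfl fun i _ => ?_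
      simp [G, hd]
      ring
    · simp only [if_neg hd] at h5
      constructor
      · rw [B_apply, h5]
        refine Finset.sum_congr rfl fun i _ => ?_
        simp [G]
      · ext i
        simp [G, hd]

end pb

end QFH

open scoped TensorProduct
namespace QFH
open QuadraticMap

variable {F : Type} [Field F] {ι : Type} [Fintype ι]

lemma two_ext (h2 : (2 : F) ≠ 0) (L : Type) [Field L] [Algebra F L] : (2 : L) ≠ 0 := by
  have := (map_ne_zero (algebraMap F L)).mpr h2
  rwa [map_ofNat] at this

lemma ext_ne (L : Type) [Field L] [Algebra F L] {w : ι → F} (hw : ∀ i, w i ≠ 0) (i : ι) :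
    ext L w i ≠ 0 := (map_ne_zero (algebraMap F L)).mpr (hw i)

lemma springer_simple (h2 : (2 : F) ≠ 0) {L : Type} [Field L] [Algebra F L] (pb : PowerBasis F L)
    (hx : pb.gen ≠ 0) (hodd : Odd pb.dim) {w : ι → F} (hw : ∀ i, w i ≠ 0) {m : ℕ}
    (hm : Fintype.card ι = 2 * m) (h : HasTI (wq (ext L w)) m) : HasTI (wq w) m := by
  obtain ⟨k, hk⟩ := hodd
  obtain ⟨T, hT, hT'⟩ := transfer pb hx k k (by omega) (by omega) hw (two_ext h2 L) h
  simp only [if_neg (show ¬ 2 * k = pb.dim by omega)] at hT'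
  have h3 : m ≤ Module.finrank F T := by
    rw [hk, hm] at hT
    nlinarith
  have h4 : Module.finrank F (T.map (LinearMap.fst F (ι → F) (ι → F))) = Module.finrank F T := by
    have e := (T.subtype).finrank_range_add_finrank_ker
    let g := (LinearMap.fst F (ι → F) (ι → F)).comp T.subtype
    have hg : Function.Injective g := by
      intro a b hab
      apply Subtype.ext
      exact Prod.ext hab ((hT' a a.2).2.trans (hT' b b.2).2.symm)
    have := LinearMap.finrank_range_of_inj hg
    rwa [LinearMap.range_comp, Submodule.range_subtype] at this
  have h5 : HasTI (wq w) (Module.finrank F T) := by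
    rw [hasTI_wq]
    refine ⟨_, ?_, h4⟩
    rintro _ ⟨t, ht, rfl⟩
    exact (hT' t ht).1
  have h6 := two_mul_le h2 (wq_nd h2 hw) h5
  rw [wq_finrank, hm] at h6
  have : Module.finrank F T = m := by omega
  rwa [this] at h5

lemma B_scale (c : F) (w : ι → F) (v : ι → F) :
    B (fun i => c * w i) v v = c * B w v v := by
  simp [B_apply, Finset.mul_sum, mul_assoc]

lemma transfer_even (h2 : (2 : F) ≠ 0) {L : Type} [Field L] [Algebra F L] (pb : PowerBasis F L)
    (hx : pb.gen ≠ 0) (heven : Even pb.dim) {w : ι → F} (hw : ∀ i, w i ≠ 0) {m : ℕ}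
    (hm : Fintype.card ι = 2 * m) (h : HasTI (wq (ext L w)) m) :
    (wq w).Equiv (wq (fun i => Algebra.norm F pb.gen * w i)) := by
  obtain ⟨k, hk⟩ := heven
  have hpos : 0 < pb.dim := pb.dim_pos
  have : FiniteDimensional F L := pb.finite
  obtain ⟨T, hT, hT'⟩ := transfer pb hx (k - 1) k (by omega) (by omega) hw (two_ext h2 L) h
  simp only [if_pos (show 2 * k = pb.dim by omega)] at hT'
  have hN : Algebra.norm F pb.gen = (minpoly F pb.gen).coeff 0 := by
    rw [Algebra.PowerBasis.norm_gen_eq_coeff_zero_minpoly, Even.neg_one_pow ⟨k, hk⟩, one_mul]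
  have hN0 : Algebra.norm F pb.gen ≠ 0 := Algebra.norm_ne_zero_iff.mpr hx
  refine lag_equiv h2 (2 * m) _ _ (wq_nd h2 hw) (wq_nd h2 fun i => mul_ne_zero hN0 (hw i))
    ((wq_finrank _).trans hm) ((wq_finrank _).trans hm) T ?_ ?_
  · rintro ⟨a, b⟩ ht
    refine (wq_q w a).trans (Eq.trans ?_ (wq_q _ b).symm)
    have := hT' _ ht
    rw [← hN] at this
    exact this.trans (B_scale _ w b).symm
  · have h3 : 2 * m ≤ Module.finrank F T := by
      obtain ⟨k, rfl⟩ : ∃ k', k = k' + 1 := ⟨k - 1, by omega⟩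
      rw [hk, hm, Nat.add_sub_cancel] at hT
      nlinarith
    exact h3

lemma ext_ext (E L : Type) [Field E] [Field L] [Algebra F E] [Algebra F L] [Algebra E L]
    [IsScalarTower F E L] (w : ι → F) : ext L (ext E w) = ext L w := by
  ext i
  exact (IsScalarTower.algebraMap_apply F E L (w i)).symm

lemma springer (n : ℕ) : ∀ (F L : Type) [Field F] [Field L] [Algebra F L] [FiniteDimensional F L],
    (2 : F) ≠ 0 → Module.finrank F L = n → Odd n → ∀ (w : ι → F), (∀ i, w i ≠ 0) → ∀ m : ℕ,
    Fintype.card ι = 2 * m → HasTI (wq (ext L w)) m → HasTI (wq w) m := by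
  induction n using Nat.strong_induction_on with
  | _ n ih =>
  intro F L _ _ _ _ h2 hn hodd w hw m hm h
  by_cases hall : ∃ y : L, y ∉ (⊥ : IntermediateField F L)
  · obtain ⟨y, hy⟩ := hall
    let E := IntermediateField.adjoin F {y}
    have hmul := Module.finrank_mul_finrank F E L
    rw [hn] at hmul
    have hyE : y ∈ E := IntermediateField.mem_adjoin_simple_self F y
    have hE1 : Module.finrank F E ≠ 1 := by
      intro h1
      rw [IntermediateField.finrank_eq_one_iff] at h1
      rw [h1] at hyE
      exact hy hyE
    have hp1 : 0 < Module.finrank F E := Module.finrank_pos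
    have hp2 : 0 < Module.finrank E L := Module.finrank_pos
    have hodd' := hodd
    rw [← hmul, Nat.odd_mul] at hodd'
    have h3 : HasTI (wq (ext E w)) m := by
      refine ih (Module.finrank E L) ?_ E L (two_ext h2 E) rfl hodd'.2 _ (ext_ne E hw) m hm ?_
      · rw [← hmul]; nlinarith [show 2 ≤ Module.finrank F E by omega]
      · rwa [ext_ext]
    let pb := IntermediateField.adjoin.powerBasis (Algebra.IsIntegral.isIntegral (R := F) y)
    refine springer_simple h2 pb ?_ ?_ hw hm h3
    · intro h0
      rw [IntermediateField.adjoin.powerBasis_gen] at h0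
      have : y = 0 := by
        have := congrArg (algebraMap E L) h0
        simpa using this
      exact hy (this ▸ zero_mem _)
    · rw [← pb.finrank]; exact hodd'.1
  · push Not at hall
    have hbot : ∀ y : L, ∃ c : F, algebraMap F L c = y := fun y =>
      IntermediateField.mem_bot.mp (hall y)
    have htop : Algebra.adjoin F {(1 : L)} = ⊤ := by
      rw [eq_top_iff]
      intro y _
      obtain ⟨c, rfl⟩ := hbot y
      exact Subalgebra.algebraMap_mem _ c
    let pb : PowerBasis F L := PowerBasis.ofAdjoinEqTop
      (Algebra.IsIntegral.isIntegral (R := F) (1 : L)) htop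
    refine springer_simple h2 pb ?_ ?_ hw hm h
    · rw [show pb.gen = 1 from PowerBasis.ofAdjoinEqTop_gen _ _]
      exact one_ne_zero
    · rw [← pb.finrank, hn]; exact hodd

lemma smul_sq_equiv {c : F} (hc : c ≠ 0) (w : ι → F) :
    (wq w).Equiv (wq (fun i => c ^ 2 * w i)) := by
  refine ⟨{ LinearEquiv.smulOfNeZero F (ι → F) c⁻¹ (inv_ne_zero hc) with map_app' := ?_ }⟩
  intro (v : ι → F)
  have h : B (fun i => c ^ 2 * w i) (c⁻¹ • v) (c⁻¹ • v) = B w v v := by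
    rw [B_scale]
    simp only [map_smul, LinearMap.smul_apply, smul_eq_mul]
    field_simp
  exact (wq_q _ (c⁻¹ • v)).trans (h.trans (wq_q w v).symm)

theorem norm_principle (h2 : (2 : F) ≠ 0) {L : Type} [Field L] [Algebra F L]
    [FiniteDimensional F L] {w : ι → F} (hw : ∀ i, w i ≠ 0) {m : ℕ}
    (hm : Fintype.card ι = 2 * m) (h : HasTI (wq (ext L w)) m) {x : L} (hx : x ≠ 0) :
    (wq w).Equiv (wq (fun i => Algebra.norm F x * w i)) := by
  let E := IntermediateField.adjoin F {x}
  let x' : E := IntermediateField.AdjoinSimple.gen F x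
  have hx' : algebraMap E L x' = x := IntermediateField.AdjoinSimple.algebraMap_gen F x
  have hx0 : x' ≠ 0 := by
    intro h0
    rw [h0, map_zero] at hx'
    exact hx hx'.symm
  have hN : Algebra.norm F x = Algebra.norm F x' ^ Module.finrank E L := by
    rw [← Algebra.norm_norm (S := E), ← hx', Algebra.norm_algebraMap, map_pow]
  have hn0 : Algebra.norm F x' ≠ 0 := Algebra.norm_ne_zero_iff.mpr hx0
  rcases Nat.even_or_odd (Module.finrank E L) with ⟨r, hr⟩ | hodd
  · have : Algebra.norm F x = (Algebra.norm F x' ^ r) ^ 2 := by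
      rw [hN, hr]; ring
    rw [this]
    exact smul_sq_equiv (pow_ne_zero _ hn0) w
  · have h3 : HasTI (wq (ext E w)) m := by
      refine springer _ E L (two_ext h2 E) rfl hodd _ (ext_ne E hw) m hm ?_
      rwa [ext_ext]
    let pb := IntermediateField.adjoin.powerBasis (Algebra.IsIntegral.isIntegral (R := F) x)
    have hgen : pb.gen = x' := IntermediateField.adjoin.powerBasis_gen _
    rcases Nat.even_or_odd pb.dim with hev | hod
    · have h4 := transfer_even h2 pb (hgen ▸ hx0) hev hw hm h3
      rw [hgen] at h4
      obtain ⟨r, hr⟩ := hodd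
      have h5 := smul_sq_equiv (pow_ne_zero r hn0) (fun i => Algebra.norm F x' * w i)
      have h6 := equiv_trans h4 h5
      convert h6 using 3 with i
      rw [hN, hr]; ring
    · have h4 := springer_simple h2 pb (hgen ▸ hx0) hod hw hm h3
      have hn : Algebra.norm F x ≠ 0 := Algebra.norm_ne_zero_iff.mpr hx
      have hnd := wq_nd h2 (w := fun i => Algebra.norm F x * w i)
        (fun i => mul_ne_zero hn (hw i))
      refine equiv_trans (equiv_hyp h2 (wq_nd h2 hw) h4 ((wq_finrank _).trans hm))
        (equiv_symm (equiv_hyp h2 hnd ?_ ((wq_finrank _).trans hm)))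
      rw [hasTI_wq] at h4 ⊢
      obtain ⟨I, hI, hIm⟩ := h4
      refine ⟨I, fun v hv => ?_, hIm⟩
      have := congrArg (fun t => Algebra.norm F x * t) (hI v hv)
      simpa [B_apply, Finset.mul_sum, mul_assoc] using this

end QFH

open scoped TensorProduct
namespace QFH
open QuadraticMap

variable {F : Type} [Field F] {ι : Type} [Fintype ι]

lemma exists_diag [Invertible (2 : F)] (φ : QF F) (h : φ.Nondeg) :
    ∃ (n : ℕ) (w : Fin n → F), (∀ i, w i ≠ 0) ∧ φ.Equiv (wq w) := by
  have hs : LinearMap.SeparatingLeft (associated φ.q) := by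
    intro v hv
    apply h.1 v
    intro u
    have h1 := hv u
    have h3 := congrArg (fun t => t v u) (two_nsmul_associated F φ.q)
    refine h3.symm.trans ?_
    change 2 • (associated φ.q v u) = 0
    rw [h1, smul_zero]
  obtain ⟨w, hw⟩ := QuadraticForm.equivalent_weightedSumSquares_units_of_nondegenerate' φ.q hs
  refine ⟨_, fun i => (w i : F), fun i => (w i).ne_zero, ?_⟩
  refine QuadraticMap.Equivalent.trans hw ?_
  refine ⟨{ LinearEquiv.refl F _ with map_app' := ?_ }⟩
  intro (v : _ → F)
  change weightedSumSquares F (fun i => (w i : F)) v = weightedSumSquares F w v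
  simp [weightedSumSquares_apply, Units.smul_def]

lemma two_ne [Invertible (2 : F)] : (2 : F) ≠ 0 := Invertible.ne_zero 2

lemma baseChange_equiv [Invertible (2 : F)] (L : Type) [Field L] [Algebra F L] {φ : QF F}
    {w : ι → F} (h : φ.Equiv (wq w)) : (φ.baseChange L).Equiv (wq (ext L w)) := by
  classical
  obtain ⟨e⟩ := h
  have h2 : (2 : L) ≠ 0 := two_ext (two_ne (F := F)) L
  letI : Invertible (2 : L) := invertibleOfNonzero h2
  let e' : φ.V ≃ₗ[F] (ι → F) := e.toLinearEquiv
  have he' : ∀ v, B w (e' v) (e' v) = φ.q v := fun v => (wq_q w (e' v)).symm.trans (e.map_app v)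
  have hp : ∀ u v, polar φ.q u v = 2 * B w (e' u) (e' v) := by
    intro u v
    rw [polar, ← he', ← he', ← he', map_add, map_add, map_add, LinearMap.add_apply,
      LinearMap.add_apply, B_comm w (e' v) (e' u)]
    ring
  let b : Module.Basis ι F φ.V := Module.Basis.ofEquivFun e'
  let bL : Module.Basis ι L (L ⊗[F] φ.V) := b.baseChange L
  have hb : ∀ i, e' (b i) = Pi.single i 1 := by
    intro i
    simp [b]
  have hpol : polarBilin (QuadraticForm.baseChange L φ.q) =
      (2 : L) • (B (ext L w)).compl₁₂ (bL.equivFun : _ →ₗ[L] _) (bL.equivFun : _ →ₗ[L] _) := by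
    rw [QuadraticForm.polarBilin_baseChange]
    refine LinearMap.BilinForm.ext_basis bL ?_
    intro i j
    have h1 : ∀ i, bL i = 1 ⊗ₜ[F] b i := fun i => Module.Basis.baseChange_apply L b i
    have h3 : ((2 : L) • (B (ext L w)).compl₁₂ (bL.equivFun : _ →ₗ[L] (ι → L))
      (bL.equivFun : _ →ₗ[L] (ι → L))) (bL i) (bL j) =
        2 * B (ext L w) (Pi.single i 1) (Pi.single j 1) := by
      have h4 : ∀ i, bL.equivFun (bL i) = Pi.single i 1 := by
        intro i
        ext j
        simp [Pi.single_apply, Finsupp.single_apply, eq_comm]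
      rw [← h4, ← h4]; rfl
    refine Eq.trans ?_ h3.symm
    rw [h1, h1, LinearMap.BilinForm.baseChange_tmul, polarBilin_apply_apply, hp, hb, hb]
    simp only [B_apply, Pi.single_apply]
    by_cases hij : i = j
    · subst hij
      simp [Algebra.smul_def, ext]
      exact Or.inl (map_ofNat (algebraMap F L) 2)
    · have hji : ¬ j = i := fun h => hij h.symm
      simp [hji]
  refine ⟨{ bL.equivFun with map_app' := ?_ }⟩
  intro (v : L ⊗[F] φ.V)
  refine (wq_q (ext L w) (bL.equivFun v)).trans ?_
  have h5 : polar (QuadraticForm.baseChange L φ.q) v v =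
      2 * B (ext L w) (bL.equivFun v) (bL.equivFun v) :=
    congrArg (fun t => t v v) hpol
  rw [polar_self] at h5
  have h6 : (2 : L) * QuadraticForm.baseChange L φ.q v =
      2 * B (ext L w) (bL.equivFun v) (bL.equivFun v) := by
    rw [← h5]; simp [two_mul, two_smul]
  exact (mul_left_cancel₀ h2 h6).symm

lemma hyp_iff [Invertible (2 : F)] (L : Type) [Field L] [Algebra F L] {φ : QF F}
    {w : ι → F} (hw : ∀ i, w i ≠ 0) (h : φ.Equiv (wq w)) :
    (φ.baseChange L).IsHyperbolic ↔ ∃ m, Fintype.card ι = 2 * m ∧ HasTI (wq (ext L w)) m := by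
  have e := baseChange_equiv L h
  have h2 : (2 : L) ≠ 0 := two_ext (two_ne (F := F)) L
  have hnd := wq_nd h2 (ext_ne L hw)
  rw [isHyperbolic_iff h2 (nd_equiv (equiv_symm e) hnd), finrank_equiv e, wq_finrank]
  constructor
  · rintro ⟨m, h1, h3⟩
    exact ⟨m, h1, hasTI_equiv e h3⟩
  · rintro ⟨m, h1, h3⟩
    exact ⟨m, h1, hasTI_equiv (equiv_symm e) h3⟩

lemma mem_Sp [Invertible (2 : F)] (L : Type) [Field L] [Algebra F L] {φ : QF F}
    {w : ι → F} (hw : ∀ i, w i ≠ 0) (h : φ.Equiv (wq w)) {r : ℕ}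
    (hr : HasTI (wq (ext L w)) r) (hmax : ∀ m, HasTI (wq (ext L w)) m → m ≤ r) :
    r ∈ QF.Sp φ := by
  have e := baseChange_equiv L h
  have h2 : (2 : L) ≠ 0 := two_ext (two_ne (F := F)) L
  have hnd := wq_nd h2 (ext_ne L hw)
  obtain ⟨h3, h4⟩ := wittIndex_spec h2 (nd_equiv (equiv_symm e) hnd)
  exact ⟨⟨L⟩, le_antisymm (h4 r (hasTI_equiv (equiv_symm e) hr)) (hmax _ (hasTI_equiv e h3))⟩

lemma Sp_finite [Invertible (2 : F)] {φ : QF F} {w : ι → F} (hw : ∀ i, w i ≠ 0)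
    (h : φ.Equiv (wq w)) : (QF.Sp φ).Finite := by
  refine (Set.finite_Iic (Fintype.card ι)).subset ?_
  rintro r ⟨L, rfl⟩
  have e := baseChange_equiv L.carrier h
  have h2 : (2 : L.carrier) ≠ 0 := two_ext (two_ne (F := F)) L.carrier
  have hnd := wq_nd h2 (ext_ne L.carrier hw)
  have h3 := (wittIndex_spec h2 (nd_equiv (equiv_symm e) hnd)).1
  have h4 := two_mul_le h2 hnd (hasTI_equiv e h3)
  rw [wq_finrank] at h4
  simp only [Set.mem_Iic]
  omega

lemma exists_max (h2 : (2 : F) ≠ 0) {w : ι → F} (hw : ∀ i, w i ≠ 0) :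
    ∃ r, HasTI (wq w) r ∧ ∀ m, HasTI (wq w) m → m ≤ r :=
  ⟨_, wittIndex_spec h2 (wq_nd h2 hw)⟩

lemma smul_wq_equiv (a : F) {φ : QF F} {w : ι → F} (h : φ.Equiv (wq w)) :
    (φ.smul a).Equiv (wq (fun i => a * w i)) := by
  obtain ⟨e⟩ := h
  refine ⟨{ e.toLinearEquiv with map_app' := ?_ }⟩
  intro (v : φ.V)
  let v' : ι → F := e v
  have h1 : B (fun i => a * w i) v' v' = a * B w v' v' := B_scale a w v'
  have h3 : (wq w).q v' = φ.q v := e.map_app v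
  have h4 : (wq (fun i => a * w i)).q v' = a * φ.q v := by
    rw [← h3]
    exact (wq_q _ v').trans (h1.trans (congrArg (fun t => a * t) (wq_q w v').symm))
  exact h4

lemma mem_G_iff {a : F} {φ : QF F} {w : ι → F} (h : φ.Equiv (wq w)) :
    a ∈ QF.G φ ↔ a ≠ 0 ∧ (wq w).Equiv (wq (fun i => a * w i)) := by
  have h1 := smul_wq_equiv a h
  constructor
  · rintro ⟨h3, h4⟩
    exact ⟨h3, equiv_trans (equiv_symm h) (equiv_trans (equiv_symm h4) h1)⟩
  · rintro ⟨h3, h4⟩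
    exact ⟨h3, equiv_trans h1 (equiv_trans (equiv_symm h4) (equiv_symm h))⟩

lemma simil (h2 : (2 : F) ≠ 0) {x : F} {w : ι → F}
    (h : (wq w).Equiv (wq (fun i => x * w i))) :
    ∃ f : (ι → F) →ₗ[F] (ι → F), ∀ u v, B w (f u) (f v) = x * B w u v := by
  obtain ⟨e⟩ := equiv_symm h
  let f : (ι → F) →ₗ[F] (ι → F) := e.toLinearEquiv.toLinearMap
  have hf : ∀ v : ι → F, B w (f v) (f v) = x * B w v v := by
    intro v
    have h1 : (wq w).q (f v) = (wq (fun i => x * w i)).q v := e.map_app v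
    have h3 : B w (f v) (f v) = B (fun i => x * w i) v v :=
      (wq_q w (f v)).symm.trans (h1.trans (wq_q _ v))
    rw [h3, B_scale]
  refine ⟨f, fun u v => ?_⟩
  have h1 := hf (u + v)
  simp only [map_add, LinearMap.add_apply, hf, B_comm w v u, B_comm w (f v) (f u)] at h1
  apply mul_left_cancel₀ h2
  linear_combination h1

lemma odd_sq {x : F} (hx : x ≠ 0) {w : ι → F} (hw : ∀ i, w i ≠ 0)
    (f : (ι → F) →ₗ[F] (ι → F)) (hf : ∀ u v, B w (f u) (f v) = x * B w u v)
    (hodd : Odd (Fintype.card ι)) : ∃ g, x = g ^ 2 := by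
  classical
  let M := LinearMap.toMatrix' f
  have hM : M.transpose * Matrix.diagonal w * M = x • Matrix.diagonal w := by
    ext i j
    have h1 := hf (Pi.single i 1) (Pi.single j 1)
    have h3 : ∀ k i, f (Pi.single i 1) k = M k i := by
      intro k i
      simp [M, LinearMap.toMatrix'_apply]
    simp only [B_apply, h3] at h1
    have h4 : ∑ k, w k * ((Pi.single i 1 : ι → F) k * (Pi.single j 1 : ι → F) k) =
        Matrix.diagonal w i j := by
      by_cases hij : i = j
      · subst hij; simp [Pi.single_apply]
      · have hji : ¬ j = i := fun h => hij h.symm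
        simp [Pi.single_apply, hij, hji]
    rw [h4] at h1
    rw [Matrix.smul_apply, smul_eq_mul, ← h1, Matrix.mul_apply]
    refine Finset.sum_congr rfl fun k _ => ?_
    rw [Matrix.mul_diagonal, Matrix.transpose_apply]
    ring
  have hd := congrArg Matrix.det hM
  rw [Matrix.det_mul, Matrix.det_mul, Matrix.det_transpose, Matrix.det_smul,
    Matrix.det_diagonal] at hd
  have hp : ∏ i, w i ≠ 0 := Finset.prod_ne_zero_iff.mpr fun i _ => hw i
  have h5 : M.det ^ 2 = x ^ Fintype.card ι := by
    apply mul_right_cancel₀ hp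
    linear_combination hd
  obtain ⟨k, hk⟩ := hodd
  refine ⟨M.det / x ^ k, ?_⟩
  rw [div_pow, h5, hk]
  field_simp
  ring

lemma hasTI_closed [IsAlgClosed F] {w : ι → F} (hw : ∀ i, w i ≠ 0) {m : ℕ}
    (hm : Fintype.card ι = 2 * m) : HasTI (wq w) m := by
  classical
  have e : ι ≃ Fin m ⊕ Fin m := Fintype.equivOfCardEq (by rw [hm]; simp [two_mul])
  have hr : ∀ k, ∃ r : F, r ^ 2 = w k := fun k => IsAlgClosed.exists_pow_nat_eq (w k) two_pos
  choose r hr using hr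
  obtain ⟨j, hj⟩ := IsAlgClosed.exists_pow_nat_eq (-1 : F) two_pos
  have hr0 : ∀ k, r k ≠ 0 := by
    intro k h
    have := hr k
    rw [h] at this
    exact hw k (by rw [← this]; ring)
  let g : (Fin m → F) →ₗ[F] (ι → F) :=
    { toFun := fun c k => (r k)⁻¹ * Sum.elim c (fun i => j * c i) (e k)
      map_add' := by
        intro a b
        ext k
        rcases h : e k with i | i <;> simp [h] <;> ring
      map_smul' := by
        intro a b
        ext k
        rcases h : e k with i | i <;> simp [h] <;> ring }
  have hg : ∀ c k, g c k = (r k)⁻¹ * Sum.elim c (fun i => j * c i) (e k) := fun _ _ => rfl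
  rw [hasTI_wq]
  refine ⟨LinearMap.range g, ?_, ?_⟩
  · rintro _ ⟨c, rfl⟩
    have h1 : B w (g c) (g c) = ∑ k, (Sum.elim c (fun i => j * c i) (e k)) ^ 2 := by
      rw [B_apply]
      refine Finset.sum_congr rfl fun k _ => ?_
      rw [hg, ← hr]
      have := hr0 k
      field_simp
    rw [h1, e.sum_comp (fun s => (Sum.elim c (fun i => j * c i) s) ^ 2), Fintype.sum_sum_type,
      ← Finset.sum_add_distrib]
    refine Finset.sum_eq_zero fun i _ => ?_
    simp only [Sum.elim_inl, Sum.elim_inr]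
    linear_combination (c i) ^ 2 * hj
  · rw [LinearMap.finrank_range_of_inj, Module.finrank_fin_fun]
    intro a b hab
    ext i
    have := congrFun hab (e.symm (Sum.inl i))
    simpa [hg, hr0] using this

end QFH

open scoped TensorProduct
namespace QFH
open QuadraticMap

variable {F : Type} [Field F] {ι : Type} [Fintype ι]

lemma twoExt_self : IsTwoExtension F F := by
  refine ⟨inferInstance, 0, fun _ => ⊥, rfl, ?_, fun i => i.elim0⟩
  rw [eq_top_iff]
  intro y _
  exact IntermediateField.mem_bot.mpr ⟨y, rfl⟩

lemma twoExt_quad (L : Type) [Field L] [Algebra F L] (h : Module.finrank F L = 2) :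
    IsTwoExtension F L := by
  refine ⟨Module.finite_of_finrank_pos (by omega), 1, ![⊥, ⊤], rfl, rfl, ?_⟩
  intro i
  fin_cases i
  refine ⟨bot_le, ?_⟩
  change IntermediateField.relfinrank (⊥ : IntermediateField F L) ⊤ = 2
  rw [IntermediateField.relfinrank_bot_left, IntermediateField.finrank_top', h]

lemma twoExt_tower (L M : Type) [Field L] [Field M] [Algebra F L] [Algebra F M] [Algebra L M]
    [IsScalarTower F L M] (h : Module.finrank F L = 2) (h' : Module.finrank L M = 2) :
    IsTwoExtension F M := by
  have hmul := Module.finrank_mul_finrank F L M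
  let E : IntermediateField F M := (IsScalarTower.toAlgHom F L M).fieldRange
  have hE : Module.finrank F E = 2 := by
    rw [← h]
    exact (AlgEquiv.ofInjectiveField (IsScalarTower.toAlgHom F L M)).toLinearEquiv.finrank_eq.symm
  have hmul2 := Module.finrank_mul_finrank F E M
  refine ⟨Module.finite_of_finrank_pos (by rw [← hmul, h, h']; norm_num), 2, ![⊥, E, ⊤], rfl, rfl, ?_⟩
  intro i
  fin_cases i
  · refine ⟨bot_le, ?_⟩
    change IntermediateField.relfinrank (⊥ : IntermediateField F M) E = 2
    rw [IntermediateField.relfinrank_bot_left, hE]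
  · refine ⟨le_top, ?_⟩
    change IntermediateField.relfinrank E ⊤ = 2
    rw [IntermediateField.relfinrank_top_right]
    rw [← hmul, hE, h, h'] at hmul2
    omega

variable [Invertible (2 : F)]

lemma H2_of_sq {φ : QF F} {x : F} (hx : x ≠ 0) (h : ∃ g, x = g ^ 2) : x ∈ QF.H2grp φ := by
  obtain ⟨g, rfl⟩ := h
  exact ⟨g, fun h => hx (by rw [h]; ring), 1, Submonoid.one_mem _, by ring⟩

lemma H2_of_norm {φ : QF F} {x s : F} (hs : s ≠ 0) {w : ι → F} (hw : ∀ i, w i ≠ 0)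
    (h : φ.Equiv (wq w)) (L : Type) [Field L] [Algebra F L] (hL : IsTwoExtension F L) {m : ℕ}
    (hm : Fintype.card ι = 2 * m) (hTI : HasTI (wq (ext L w)) m) {y : L} (hy : y ≠ 0)
    (hx : x = s ^ 2 * Algebra.norm F y) : x ∈ QF.H2grp φ := by
  refine ⟨s, hs, _, Submonoid.subset_closure ?_, hx⟩
  exact ⟨⟨L⟩, hL, (hyp_iff L hw h).mpr ⟨m, hm, hTI⟩, y, hy, rfl⟩

lemma G_sub_H2 {φ : QF F} {w : ι → F} (hw : ∀ i, w i ≠ 0) (h : φ.Equiv (wq w))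
    (hSp : (QF.Sp φ).ncard ≤ 3) : QF.G φ ⊆ QF.H2grp φ := by
  have h2 : (2 : F) ≠ 0 := two_ne
  intro x hx
  obtain ⟨hx0, hxe⟩ := (mem_G_iff h).mp hx
  obtain ⟨f, hf⟩ := simil h2 hxe
  rcases Nat.even_or_odd (Fintype.card ι) with ⟨m, hm⟩ | hodd
  swap
  · exact H2_of_sq hx0 (odd_sq hx0 hw f hf hodd)
  replace hm : Fintype.card ι = 2 * m := by omega
  have hbound : ∀ (L : Type) [Field L] [Algebra F L] (r : ℕ), HasTI (wq (ext L w)) r → r ≤ m := by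
    intro L _ _ r hr
    have := two_mul_le (two_ext h2 L) (wq_nd (two_ext h2 L) (ext_ne L hw)) hr
    rw [wq_finrank] at this
    omega
  -- level 0
  obtain ⟨r0, hr0, hmax0⟩ := exists_max h2 hw
  by_cases h0 : r0 = m
  · refine H2_of_norm (x := x) (s := 1) one_ne_zero hw h F twoExt_self hm (h0 ▸ hr0) hx0 ?_
    simp [Algebra.norm_self]
  have hlt0 : r0 < m := lt_of_le_of_ne (hbound F r0 hr0) h0
  obtain ⟨I, hI, rfl⟩ := hasTI_wq.mp hr0
  rcases step1 h2 hI (fun hh => by have := hmax0 _ hh; omega) (by omega) hx0 f hf with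
    hsq | ⟨b, β, c, hF, hc, hxc, hTI1⟩
  · exact H2_of_sq hx0 hsq
  -- level 1
  obtain ⟨r1, hr1, hmax1⟩ := exists_max (two_ext h2 (QuadraticAlgebra F b 0))
    (ext_ne (QuadraticAlgebra F b 0) hw)
  have h01 := hmax1 _ hTI1
  have hfL : Module.finrank F (QuadraticAlgebra F b 0) = 2 := QuadraticAlgebra.finrank_eq_two ..
  by_cases h1 : r1 = m
  · refine H2_of_norm (x := x) (s := c⁻¹) (inv_ne_zero hc) hw h (QuadraticAlgebra F b 0)
      (twoExt_quad _ hfL) hm (h1 ▸ hr1) (y := ⟨β, 1⟩) ?_ ?_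
    · intro hy
      have := congrArg QuadraticAlgebra.im hy
      simp at this
    · rw [norm_quad]
      field_simp
      linear_combination hxc
  have hlt1 : r1 < m := lt_of_le_of_ne (hbound _ r1 hr1) h1
  obtain ⟨I1, hI1, rfl⟩ := hasTI_wq.mp hr1
  obtain ⟨y, s, hy, hs, hN, hcase⟩ := step2 b h2 hI1
    (fun hh => by have := hmax1 _ hh; omega) (by omega) (β := β) (c • f)
    (by
      intro u v
      simp only [LinearMap.smul_apply, map_smul, smul_eq_mul, hf, ← hxc]
      ring)
  have hNy : Algebra.norm F y ≠ 0 := by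
    intro h0
    rw [h0, zero_mul] at hN
    exact hs (pow_eq_zero_iff two_ne_zero |>.mp hN.symm)
  have hxN : x = (s / (c * Algebra.norm F y)) ^ 2 * Algebra.norm F y := by
    rw [← hxc] at hN
    field_simp
    linear_combination hN
  rcases hcase with ⟨g, hg⟩ | ⟨b', β', hF', hy', hTI2⟩
  · refine H2_of_sq hx0 ⟨s / (c * Algebra.norm F y) * Algebra.norm F g, ?_⟩
    have : Algebra.norm F y = Algebra.norm F g ^ 2 := by rw [hg, map_pow]
    rw [mul_pow, ← this]
    exact hxN
  -- level 2
  rw [ext_ext] at hTI2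
  set M := QuadraticAlgebra (QuadraticAlgebra F b 0) b' 0 with hM
  obtain ⟨r2, hr2, hmax2⟩ := exists_max (two_ext h2 M) (ext_ne M hw)
  have h12 := hmax2 _ hTI2
  have hfM : Module.finrank (QuadraticAlgebra F b 0) M = 2 := QuadraticAlgebra.finrank_eq_two ..
  by_cases h2m : r2 = m
  · refine H2_of_norm (x := x) (s := s / (c * Algebra.norm F y))
      (div_ne_zero hs (mul_ne_zero hc hNy)) hw h M
      (twoExt_tower (QuadraticAlgebra F b 0) M hfL hfM) hm (h2m ▸ hr2) (y := ⟨β', 1⟩) ?_ ?_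
    · intro hy
      have := congrArg QuadraticAlgebra.im hy
      simp at this
    · have hny : Algebra.norm (QuadraticAlgebra F b 0) (⟨β', 1⟩ : M) = y := by
        rw [norm_quad, hy']
        ring
      rw [← Algebra.norm_norm (S := QuadraticAlgebra F b 0) (a := (⟨β', 1⟩ : M)), hny]
      exact hxN
  have hlt2 : r2 < m := lt_of_le_of_ne (hbound _ r2 hr2) h2m
  exfalso
  have m0 := mem_Sp F hw h (r := Module.finrank F I) hr0 hmax0
  have m1 := mem_Sp _ hw h hr1 hmax1
  have m2 := mem_Sp _ hw h hr2 hmax2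
  have m3 := mem_Sp (AlgebraicClosure F) hw h (r := m)
    (hasTI_closed (ext_ne (AlgebraicClosure F) hw) hm) (hbound _)
  set a := Module.finrank F I
  set a1 := Module.finrank (QuadraticAlgebra F b 0) I1
  have hsub : ((({a, a1, r2, m} : Finset ℕ)) : Set ℕ) ⊆ QF.Sp φ := by
    intro t ht
    simp only [Finset.coe_insert, Finset.coe_singleton, Set.mem_insert_iff,
      Set.mem_singleton_iff] at ht
    rcases ht with rfl | rfl | rfl | rfl <;> assumption
  have hcard := Set.ncard_le_ncard hsub (Sp_finite hw h)
  rw [Set.ncard_coe_finset] at hcard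
  have : ({a, a1, r2, m} : Finset ℕ).card = 4 := by
    rw [Finset.card_insert_of_notMem, Finset.card_insert_of_notMem, Finset.card_insert_of_notMem,
      Finset.card_singleton]
    all_goals simp
    all_goals omega
  omega

lemma H2_sub_H (φ : QF F) : QF.H2grp φ ⊆ QF.Hgrp φ := by
  rintro x ⟨s, hs, y, hy, rfl⟩
  refine ⟨s, hs, y, ?_, rfl⟩
  refine Submonoid.closure_mono ?_ hy
  rintro a ⟨L, hL, h1, h3⟩
  exact ⟨L, hL.1, h1, h3⟩

lemma G_mul {φ : QF F} {w : ι → F} (h : φ.Equiv (wq w)) {a b : F} (ha : a ∈ QF.G φ)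
    (hb : b ∈ QF.G φ) : a * b ∈ QF.G φ := by
  rw [mem_G_iff h] at ha hb ⊢
  refine ⟨mul_ne_zero ha.1 hb.1, ?_⟩
  have h1 := smul_wq_equiv a hb.2
  have h3 := smul_wq_equiv a (equiv_refl (wq w))
  have h4 := equiv_trans ha.2 (equiv_trans (equiv_symm h3) h1)
  simpa only [mul_assoc] using h4

lemma H_sub_G {φ : QF F} {w : ι → F} (hw : ∀ i, w i ≠ 0) (h : φ.Equiv (wq w)) :
    QF.Hgrp φ ⊆ QF.G φ := by
  have h2 : (2 : F) ≠ 0 := two_ne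
  rintro x ⟨s, hs, y, hy, rfl⟩
  refine G_mul h ((mem_G_iff h).mpr ⟨pow_ne_zero _ hs, smul_sq_equiv hs w⟩) ?_
  refine Submonoid.closure_induction (motive := fun z _ => z ∈ QF.G φ) ?_ ?_ ?_ hy
  · rintro a ⟨L, hL, h1, z, hz, rfl⟩
    obtain ⟨m, hm, hTI⟩ := (hyp_iff L.carrier hw h).mp h1
    exact (mem_G_iff h).mpr ⟨Algebra.norm_ne_zero_iff.mpr hz, norm_principle h2 hw hm hTI hz⟩
  · rw [mem_G_iff h]
    refine ⟨one_ne_zero, ?_⟩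
    simpa only [one_mul] using equiv_refl (wq w)
  · intro a b _ _ ha hb
    exact G_mul h ha hb

end QFH

/-- a form of height at most 2 satisfies `G(φ) = K×²·Hyp₂(φ) = H(φ)`. -/
theorem stmt6 (K : Type) [Field K] [Invertible (2 : K)]
    (φ : QF K) (hφ : φ.Nondeg) (hht : (QF.Sp φ).ncard ≤ 3) :
    QF.G φ = QF.H2grp φ ∧ QF.G φ = QF.Hgrp φ := by
  obtain ⟨n, w, hw, h⟩ := QFH.exists_diag φ hφ
  have h1 := QFH.G_sub_H2 hw h hht
  have h2 := QFH.H2_sub_H φ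
  have h3 := QFH.H_sub_G hw h
  exact ⟨Set.Subset.antisymm h1 (h2.trans h3), Set.Subset.antisymm (h1.trans h2) h3⟩
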